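/- arXiv:1905.07426 — 2 statements merged into one kernel-verified Lean document; each statement's English description precedes it below -/
import Mathlib

section
/- Let α ∈ (0,1) and let r satisfy 1 ≤ r ≤ (2−α)/α. Let the temporal mesh be quasi-graded with parameter r and constants c_0 ≤ C_0. Then there exists a constant C > 0, depending only on α, γ, r, T, c_0, C_0, such that: for every γ ∈ ℝ and every real sequence V^0,...,V^M with V^0 = 0 and |δ_t^α V^j| ≤ (τ/t_j)^{γ+1} for all j = 1,...,M, one has |V^j| ≤ C 𝒱^j for all j = 1,...,M. -/
open Real MeasureTheory Set

/-- The L1 discrete fractional-derivative operator associated with the mesh `t`,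
applied to the sequence `V`, at time level `m`. -/
noncomputable def deltaL1 (α : ℝ) (t : ℕ → ℝ) (V : ℕ → ℝ) (m : ℕ) : ℝ :=
  (1 / Real.Gamma (1 - α)) *
    ∑ j ∈ Finset.Icc 1 m,
      ((V j - V (j - 1)) / (t j - t (j - 1))) *
        ∫ s in (t (j - 1))..(t j), (t m - s) ^ (-α)

/-- `t 0 = 0 < t 1 < ... < t M = T` with `M ≥ 2`. -/
def IsMesh (T : ℝ) (M : ℕ) (t : ℕ → ℝ) : Prop :=
  2 ≤ M ∧ t 0 = 0 ∧ (∀ j, j < M → t j < t (j + 1)) ∧ t M = T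

/-- Quasi-graded mesh with parameter `r` and constants `c0 ≤ C0`. -/
def QuasiGraded (r c0 C0 : ℝ) (M : ℕ) (t : ℕ → ℝ) : Prop :=
  (c0 * (M : ℝ) ^ (-r) ≤ t 1 ∧ t 1 ≤ C0 * (M : ℝ) ^ (-r)) ∧
  (∀ j : ℕ, 1 ≤ j → j ≤ M →
    c0 * (t 1 * (j : ℝ) ^ r) ≤ t j ∧ t j ≤ C0 * (t 1 * (j : ℝ) ^ r)) ∧
  (∀ j : ℕ, 1 ≤ j → j ≤ M →
    c0 * ((t 1) ^ (1 / r) * (t j) ^ (1 - 1 / r)) ≤ t j - t (j - 1) ∧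
    t j - t (j - 1) ≤ C0 * ((t 1) ^ (1 / r) * (t j) ^ (1 - 1 / r)))

/-- The stability majorant `𝒱^j`. -/
noncomputable def Vcal (α γ τ tj : ℝ) : ℝ :=
  if 0 < γ then τ * tj ^ (α - 1)
  else if γ = 0 then τ * tj ^ (α - 1) * (1 + Real.log (tj / τ))
  else τ * tj ^ (α - 1) * (τ / tj) ^ γ

/-- Weight of the increment over `[x j, x (j + 1)]` in the L1 operator at level `m`, up to the
factor `1 / Γ(2 - α)`. -/
noncomputable def l1Weight (α : ℝ) (x : ℕ → ℝ) (m j : ℕ) : ℝ :=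
  ((x m - x j) ^ (1 - α) - (x m - x (j + 1)) ^ (1 - α)) / (x (j + 1) - x j)

/-- The L1 operator multiplied by `Γ(2 - α)`. -/
noncomputable def l1Sum (α : ℝ) (x V : ℕ → ℝ) (m : ℕ) : ℝ :=
  ∑ j ∈ Finset.range m, (V (j + 1) - V j) * l1Weight α x m j

theorem integral_sub_rpow_neg {α a b t : ℝ} (hα : α < 1) :
    ∫ s in a..b, (t - s) ^ (-α) = ((t - a) ^ (1 - α) - (t - b) ^ (1 - α)) / (1 - α) := by
  rw [intervalIntegral.integral_comp_sub_left (fun u => u ^ (-α)) t,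
    integral_rpow (Or.inl (by linarith))]
  congr 1 <;> ring_nf

theorem deltaL1_eq_l1Sum {α : ℝ} (hα : α < 1) (t V : ℕ → ℝ) (m : ℕ) :
    deltaL1 α t V m = l1Sum α t V m / Real.Gamma (2 - α) := by
  have hΓ : Real.Gamma (2 - α) = (1 - α) * Real.Gamma (1 - α) := by
    rw [← Real.Gamma_add_one (by linarith)]; ring_nf
  have h1 : (1 - α) ≠ 0 := by linarith
  have h2 : Real.Gamma (1 - α) ≠ 0 := (Real.Gamma_pos_of_pos (by linarith)).ne'
  have hI : Finset.Icc 1 m = Finset.Ico 1 (m + 1) := by ext; simp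
  rw [deltaL1, l1Sum, hΓ, Finset.mul_sum, Finset.sum_div, hI, Finset.sum_Ico_eq_sum_range]
  refine Finset.sum_congr rfl fun j _ => ?_
  simp only [add_comm 1 j, Nat.add_sub_cancel, integral_sub_rpow_neg hα, l1Weight]
  rcases eq_or_ne (t (j + 1) - t j) 0 with h | h
  · simp [h]
  · field_simp

theorem l1Sum_smul (α : ℝ) (x V : ℕ → ℝ) (c : ℝ) (m : ℕ) :
    l1Sum α x (fun j => c * V j) m = c * l1Sum α x V m := by
  simp only [l1Sum, Finset.mul_sum]
  exact Finset.sum_congr rfl fun j _ => by ring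

theorem l1Sum_sub (α : ℝ) (x V W : ℕ → ℝ) (m : ℕ) :
    l1Sum α x (fun j => V j - W j) m = l1Sum α x V m - l1Sum α x W m := by
  simp only [l1Sum, ← Finset.sum_sub_distrib]
  exact Finset.sum_congr rfl fun j _ => by ring

theorem l1Sum_sum {ι : Type*} (α : ℝ) (x : ℕ → ℝ) (s : Finset ι) (V : ι → ℕ → ℝ) (m : ℕ) :
    l1Sum α x (fun j => ∑ i ∈ s, V i j) m = ∑ i ∈ s, l1Sum α x (V i) m := by
  simp only [l1Sum]
  rw [Finset.sum_comm]
  refine Finset.sum_congr rfl fun j _ => ?_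
  rw [← Finset.sum_sub_distrib, Finset.sum_mul]

/-- Scaling of the L1 operator under dilation of the mesh. -/
theorem l1Sum_div_mesh {α τ : ℝ} (hτ : 0 < τ) {t : ℕ → ℝ} {m : ℕ}
    (ht : ∀ j ≤ m, t j ≤ t m) (V : ℕ → ℝ) :
    l1Sum α (fun j => t j / τ) V m = τ ^ α * l1Sum α t V m := by
  simp only [l1Sum, Finset.mul_sum]
  refine Finset.sum_congr rfl fun j hj => ?_
  have hj := Finset.mem_range.1 hj
  have h0 := ht j hj.le
  have h1 := ht (j + 1) hj
  simp only [l1Weight, ← sub_div]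
  rw [Real.div_rpow (by linarith) hτ.le, Real.div_rpow (by linarith) hτ.le,
    Real.rpow_sub hτ, Real.rpow_one]
  have := (Real.rpow_pos_of_pos hτ α).ne'
  field_simp

theorem l1Weight_nonneg {α : ℝ} (hα1 : α < 1) {x : ℕ → ℝ} {m j : ℕ}
    (h1 : x j < x (j + 1)) (h2 : x (j + 1) ≤ x m) : 0 ≤ l1Weight α x m j := by
  refine div_nonneg (sub_nonneg.2 ?_) (by linarith)
  exact Real.rpow_le_rpow (by linarith) (by linarith) (by linarith)

theorem l1Weight_pos {α : ℝ} (hα1 : α < 1) {x : ℕ → ℝ} {m j : ℕ}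
    (h1 : x j < x (j + 1)) (h2 : x (j + 1) ≤ x m) : 0 < l1Weight α x m j := by
  refine div_pos (sub_pos.2 ?_) (by linarith)
  exact Real.rpow_lt_rpow (by linarith) (by linarith) (by linarith)

theorem l1Weight_mono {α : ℝ} (hα0 : 0 < α) (hα1 : α < 1) {x : ℕ → ℝ} {m j : ℕ}
    (h0 : x j < x (j + 1)) (h1 : x (j + 1) < x (j + 2)) (h2 : x (j + 2) ≤ x m) :
    l1Weight α x m j ≤ l1Weight α x m (j + 1) := by
  have h := (Real.concaveOn_rpow (p := 1 - α) (by linarith) (by linarith)).slope_anti_adjacent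
    (x := x m - x (j + 2)) (y := x m - x (j + 1)) (z := x m - x j)
    (by simp only [Set.mem_Ici]; linarith) (by simp only [Set.mem_Ici]; linarith)
    (by linarith) (by linarith)
  simpa only [l1Weight, sub_sub_sub_cancel_left] using h

/-- Discrete maximum principle for the L1 operator. -/
theorem nonneg_of_l1Sum_nonneg {α : ℝ} (hα0 : 0 < α) (hα1 : α < 1) {x : ℕ → ℝ} {J : ℕ}
    (hx : ∀ i j, i < j → j ≤ J → x i < x j) {U : ℕ → ℝ} (hU0 : 0 ≤ U 0)
    (hU : ∀ m, 1 ≤ m → m ≤ J → 0 ≤ l1Sum α x U m) : ∀ m ≤ J, 0 ≤ U m := by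
  intro m
  induction m using Nat.strong_induction_on with
  | _ m ih =>
    intro hm
    rcases Nat.eq_zero_or_pos m with rfl | hm0
    · exact hU0
    obtain ⟨N, rfl⟩ : ∃ N, m = N + 1 := ⟨m - 1, by omega⟩
    have hle : ∀ j ≤ N + 1, x j ≤ x (N + 1) := fun j hj => by
      rcases hj.eq_or_lt with rfl | h
      · exact le_rfl
      · exact (hx _ _ h hm).le
    have key : ∀ n ≤ N, ∑ j ∈ Finset.range (n + 1), (U (j + 1) - U j) * l1Weight α x (N + 1) j
        ≤ l1Weight α x (N + 1) n * U (n + 1) := by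
      intro n
      induction n with
      | zero =>
        intro _
        have := l1Weight_nonneg hα1 (m := N + 1) (hx 0 1 (by omega) (by omega)) (hle 1 (by omega))
        simp only [zero_add, Finset.sum_range_one]
        nlinarith
      | succ n ihn =>
        intro hn
        rw [Finset.sum_range_succ]
        have h1 := ihn (by omega)
        have h2 := l1Weight_mono hα0 hα1 (m := N + 1) (hx n (n + 1) (by omega) (by omega))
          (hx (n + 1) (n + 2) (by omega) (by omega)) (hle (n + 2) (by omega))
        have h3 := ih (n + 1) (by omega) (by omega)
        nlinarith [mul_le_mul_of_nonneg_right h2 h3]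
    have h1 := (hU _ hm0 hm).trans (key N le_rfl)
    exact nonneg_of_mul_nonneg_right h1
      (l1Weight_pos hα1 (hx N (N + 1) (by omega) hm) le_rfl)

/-! ### Tangent-line inequalities for powers -/

theorem rpow_sub_rpow_le_of_nonpos {q a b : ℝ} (hq : q ≤ 0) (ha : 0 < a) (hb : 0 < b) :
    a ^ q - b ^ q ≤ -q * a ^ (q - 1) * (b - a) := by
  have hy : 0 < b / a := by positivity
  have h1 : 1 + q * (b / a - 1) ≤ (b / a) ^ q := by
    rw [Real.rpow_def_of_pos hy]
    have := Real.add_one_le_exp (Real.log (b / a) * q)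
    nlinarith [Real.log_le_sub_one_of_pos hy]
  rw [Real.div_rpow hb.le ha.le, le_div_iff₀ (Real.rpow_pos_of_pos ha q)] at h1
  rw [Real.rpow_sub_one ha.ne']
  have : (1 + q * (b / a - 1)) * a ^ q = a ^ q + q * (a ^ q / a) * (b - a) := by
    field_simp
  linarith

theorem rpow_le_tangent {β u v : ℝ} (h0 : 0 ≤ β) (h1 : β ≤ 1) (hu : 0 < u) (hv : 0 ≤ v) :
    v ^ β ≤ u ^ β + β * u ^ (β - 1) * (v - u) := by
  have h := rpow_one_add_le_one_add_mul_self (s := v / u - 1) (p := β)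
    (by have : 0 ≤ v / u := by positivity
        linarith) h0 h1
  rw [add_sub_cancel, Real.div_rpow hv hu.le, div_le_iff₀ (Real.rpow_pos_of_pos hu β)] at h
  rw [Real.rpow_sub_one hu.ne']
  have : (1 + β * (v / u - 1)) * u ^ β = u ^ β + β * (u ^ β / u) * (v - u) := by
    field_simp
  linarith

theorem tangent_le_rpow {r u v : ℝ} (h1 : 1 ≤ r) (hu : 0 < u) (hv : 0 ≤ v) :
    u ^ r + r * u ^ (r - 1) * (v - u) ≤ v ^ r := by
  have h := one_add_mul_self_le_rpow_one_add (s := v / u - 1) (p := r)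
    (by have : 0 ≤ v / u := by positivity
        linarith) h1
  rw [add_sub_cancel, Real.div_rpow hv hu.le, le_div_iff₀ (Real.rpow_pos_of_pos hu r)] at h
  rw [Real.rpow_sub_one hu.ne']
  have : (1 + r * (v / u - 1)) * u ^ r = u ^ r + r * (u ^ r / u) * (v - u) := by
    field_simp
  linarith

/-! ### Comparison of the discrete and the continuous operator on one cell -/

/-- A primitive of `s ↦ -(1 - α) s ^ (α - 2) (t - s) ^ (-α)`. -/
noncomputable def kernelPrimitive (α t s : ℝ) : ℝ :=
  s ^ (α - 1) * (t - s) ^ (1 - α) / t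

theorem hasDerivAt_kernelPrimitive {α t s : ℝ} (hs : 0 < s) (hst : s < t) :
    HasDerivAt (kernelPrimitive α t) (-((1 - α) * s ^ (α - 2) * (t - s) ^ (-α))) s := by
  have hts : 0 < t - s := sub_pos.2 hst
  have h1 : HasDerivAt (fun s : ℝ => s ^ (α - 1)) ((α - 1) * s ^ (α - 1 - 1)) s :=
    Real.hasDerivAt_rpow_const (Or.inl hs.ne')
  have h2 : HasDerivAt (fun s : ℝ => (t - s) ^ (1 - α)) (-1 * (1 - α) * (t - s) ^ (1 - α - 1)) s :=
    ((hasDerivAt_id s).const_sub t).rpow_const (Or.inl hts.ne')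
  refine ((h1.mul h2).div_const t).congr_deriv ?_
  have e1 : s ^ (α - 1) = s ^ (α - 2) * s := by
    rw [← Real.rpow_add_one hs.ne']; ring_nf
  have e2 : (t - s) ^ (1 - α) = (t - s) ^ (-α) * (t - s) := by
    rw [← Real.rpow_add_one hts.ne']; ring_nf
  rw [show α - 1 - 1 = α - 2 by ring, show 1 - α - 1 = -α by ring, e1, e2]
  have : t ≠ 0 := by linarith
  field_simp
  ring

theorem kernelPrimitive_sub_ge {α a b t : ℝ} (hα0 : 0 < α) (hα1 : α < 1) (ha : 0 < a)
    (hab : a < b) (hbt : b ≤ t) :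
    (1 - α) * (t - a) ^ (-α) * (a ^ (α - 1) - b ^ (α - 1)) + (1 - α) * b ^ (α - 2) *
      ((t - a) ^ (1 - α) - (t - b) ^ (1 - α) - (1 - α) * (t - a) ^ (-α) * (b - a)) ≤
    (1 - α) * (kernelPrimitive α t a - kernelPrimitive α t b) := by
  set k := (t - a) ^ (-α) with hk
  set g := (1 - α) * b ^ (α - 2) with hg
  let Φ : ℝ → ℝ := fun s => -(1 - α) * kernelPrimitive α t s + (1 - α) * k * s ^ (α - 1)
    + g * ((t - s) ^ (1 - α) + (1 - α) * k * s)
  have hmono : MonotoneOn Φ (Set.Icc a b) := by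
    refine monotoneOn_of_hasDerivWithinAt_nonneg (convex_Icc a b)
      (f' := fun s => (1 - α) * (((1 - α) * s ^ (α - 2) - g) * ((t - s) ^ (-α) - k))) ?_ ?_ ?_
    · have hne : ∀ s ∈ Set.Icc a b, s ≠ 0 ∨ 0 ≤ α - 1 := fun s hs => Or.inl (by linarith [hs.1])
      have hp : ∀ s ∈ Set.Icc a b, t - s ≠ 0 ∨ 0 ≤ 1 - α := fun s _ => Or.inr (by linarith)
      have c1 : ContinuousOn (fun s : ℝ => s ^ (α - 1)) (Set.Icc a b) :=
        continuousOn_id.rpow_const hne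
      have c2 : ContinuousOn (fun s : ℝ => (t - s) ^ (1 - α)) (Set.Icc a b) :=
        (continuousOn_const.sub continuousOn_id).rpow_const hp
      have c3 : ContinuousOn (kernelPrimitive α t) (Set.Icc a b) := (c1.mul c2).div_const t
      fun_prop
    · intro s hs
      rw [interior_Icc] at hs
      have hs0 : 0 < s := ha.trans hs.1
      have hst : s < t := hs.2.trans_le hbt
      have h1 : HasDerivAt (fun s : ℝ => s ^ (α - 1)) ((α - 1) * s ^ (α - 1 - 1)) s :=
        Real.hasDerivAt_rpow_const (Or.inl hs0.ne')
      have h2 : HasDerivAt (fun s : ℝ => (t - s) ^ (1 - α))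
          (-1 * (1 - α) * (t - s) ^ (1 - α - 1)) s :=
        ((hasDerivAt_id s).const_sub t).rpow_const (Or.inl (sub_pos.2 hst).ne')
      have h3 := hasDerivAt_kernelPrimitive (α := α) hs0 hst
      refine HasDerivAt.hasDerivWithinAt ?_
      refine (((h3.const_mul (-(1 - α))).add (h1.const_mul ((1 - α) * k))).add
        ((h2.add ((hasDerivAt_id s).const_mul ((1 - α) * k))).const_mul g)).congr_deriv ?_
      rw [show α - 1 - 1 = α - 2 by ring, show 1 - α - 1 = -α by ring]
      ring
    · intro s hs
      rw [interior_Icc] at hs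
      have hs0 : 0 < s := ha.trans hs.1
      have hst : 0 < t - s := by linarith [hs.2]
      refine mul_nonneg (by linarith) (mul_nonneg (sub_nonneg.2 ?_) (sub_nonneg.2 ?_))
      · exact mul_le_mul_of_nonneg_left
          (Real.rpow_le_rpow_of_nonpos hs0 hs.2.le (by linarith)) (by linarith)
      · exact Real.rpow_le_rpow_of_nonpos hst (by linarith [hs.1]) (by linarith)
  have h := hmono (Set.left_mem_Icc.2 hab.le) (Set.right_mem_Icc.2 hab.le) hab.le
  simp only [Φ] at h
  nlinarith [h]

/-- The slope-kernel product on a cell, up to a product of two first-order oscillations. -/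
theorem cell_le {α a b t : ℝ} (hα0 : 0 < α) (hα1 : α < 1) (ha : 0 < a)
    (hab : a < b) (hbt : b ≤ t) :
    (a ^ (α - 1) - b ^ (α - 1)) * (((t - a) ^ (1 - α) - (t - b) ^ (1 - α)) / (b - a)) ≤
      (1 - α) * (kernelPrimitive α t a - kernelPrimitive α t b) + 2 * a ^ (α - 3) * (b - a) *
        ((t - a) ^ (1 - α) - (t - b) ^ (1 - α) - (1 - α) * (t - a) ^ (-α) * (b - a)) := by
  have hb : 0 < b := ha.trans hab
  have hba : 0 < b - a := sub_pos.2 hab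
  have h := kernelPrimitive_sub_ge hα0 hα1 ha hab hbt
  set k := (t - a) ^ (-α) with hk
  set A := (t - a) ^ (1 - α) - (t - b) ^ (1 - α) with hA
  have hQ : 0 ≤ A - (1 - α) * k * (b - a) := by
    have := rpow_le_tangent (β := 1 - α) (u := t - a) (v := t - b) (by linarith) (by linarith)
      (by linarith) (by linarith)
    rw [show 1 - α - 1 = -α by ring] at this
    rw [hA, hk]; linarith
  have hD : (a ^ (α - 1) - b ^ (α - 1)) / (b - a) ≤ (1 - α) * a ^ (α - 2) := by
    rw [div_le_iff₀ hba]
    have := rpow_sub_rpow_le_of_nonpos (q := α - 1) (by linarith) ha hb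
    rw [show α - 1 - 1 = α - 2 by ring] at this
    linarith
  have hg : (1 - α) * a ^ (α - 2) - (1 - α) * b ^ (α - 2) ≤ 2 * a ^ (α - 3) * (b - a) := by
    have h1 := rpow_sub_rpow_le_of_nonpos (q := α - 2) (by linarith) ha hb
    rw [show α - 2 - 1 = α - 3 by ring] at h1
    have h2 : 0 < a ^ (α - 3) * (b - a) := mul_pos (Real.rpow_pos_of_pos ha _) hba
    have h3 := mul_le_mul_of_nonneg_left h1 (show 0 ≤ 1 - α by linarith)
    have h4 := mul_le_mul_of_nonneg_right (show (1 - α) * (2 - α) ≤ 2 by nlinarith) h2.le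
    linarith
  set D := (a ^ (α - 1) - b ^ (α - 1)) / (b - a) with hDdef
  have hDe : a ^ (α - 1) - b ^ (α - 1) = D * (b - a) := by rw [hDdef]; field_simp
  rw [hDe] at h ⊢
  have e : D * (b - a) * (A / (b - a)) = D * A := by field_simp
  rw [e]
  have := mul_le_mul_of_nonneg_right
    (show D - (1 - α) * b ^ (α - 2) ≤ 2 * a ^ (α - 3) * (b - a) by linarith) hQ
  nlinarith

theorem cell_le_of_lt {α a b t : ℝ} (hα0 : 0 < α) (hα1 : α < 1) (ha : 0 < a)
    (hab : a < b) (hbt : b < t) :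
    (a ^ (α - 1) - b ^ (α - 1)) * (((t - a) ^ (1 - α) - (t - b) ^ (1 - α)) / (b - a)) ≤
      (1 - α) * (kernelPrimitive α t a - kernelPrimitive α t b) +
        2 * a ^ (α - 3) * (b - a) ^ 3 * (t - b) ^ (-(1 + α)) := by
  refine (cell_le hα0 hα1 ha hab hbt.le).trans (add_le_add_right ?_ _)
  have hba : 0 < b - a := sub_pos.2 hab
  have hb : 0 < t - b := sub_pos.2 hbt
  have h0 : 0 < a ^ (α - 3) * (b - a) := mul_pos (Real.rpow_pos_of_pos ha _) hba
  have h1 := rpow_le_tangent (β := 1 - α) (u := t - b) (v := t - a) (by linarith) (by linarith)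
    hb (by linarith)
  have h2 := rpow_sub_rpow_le_of_nonpos (q := -α) (a := t - b) (b := t - a) (by linarith) hb
    (by linarith)
  rw [show 1 - α - 1 = -α by ring] at h1
  rw [show -α - 1 = -(1 + α) by ring] at h2
  set K := (t - b) ^ (-(1 + α)) with hK
  have hK0 : 0 < K := Real.rpow_pos_of_pos hb _
  have h3 : (t - a) ^ (1 - α) - (t - b) ^ (1 - α) - (1 - α) * (t - a) ^ (-α) * (b - a) ≤
      (b - a) ^ 2 * K := by
    have e : (1 - α) * (b - a) * (α * K * (b - a)) = ((1 - α) * α) * ((b - a) ^ 2 * K) := by ring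
    have h4 := mul_le_mul_of_nonneg_left h2 (show 0 ≤ (1 - α) * (b - a) by nlinarith)
    have h5 : ((1 - α) * α) * ((b - a) ^ 2 * K) ≤ 1 * ((b - a) ^ 2 * K) :=
      mul_le_mul_of_nonneg_right (by nlinarith) (by positivity)
    nlinarith
  calc _ ≤ 2 * a ^ (α - 3) * (b - a) * ((b - a) ^ 2 * K) :=
        mul_le_mul_of_nonneg_left h3 (by linarith)
    _ = _ := by ring

theorem cell_le_last {α a t : ℝ} (hα0 : 0 < α) (hα1 : α < 1) (ha : 0 < a) (hat : a < t) :
    (a ^ (α - 1) - t ^ (α - 1)) * (((t - a) ^ (1 - α) - (t - t) ^ (1 - α)) / (t - a)) ≤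
      (1 - α) * (kernelPrimitive α t a - kernelPrimitive α t t) +
        2 * a ^ (α - 3) * (t - a) ^ (2 - α) := by
  refine (cell_le hα0 hα1 ha hat le_rfl).trans (add_le_add_right ?_ _)
  have hta : 0 < t - a := sub_pos.2 hat
  have h0 : 0 < a ^ (α - 3) * (t - a) := mul_pos (Real.rpow_pos_of_pos ha _) hta
  have e : (t - a) ^ (2 - α) = (t - a) ^ (1 - α) * (t - a) := by
    rw [← Real.rpow_add_one hta.ne']; ring_nf
  have e0 : (t - t) ^ (1 - α) = 0 := by rw [sub_self, Real.zero_rpow (by linarith)]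
  have h1 : 0 ≤ (1 - α) * (t - a) ^ (-α) * (t - a) :=
    mul_nonneg (mul_nonneg (by linarith) (Real.rpow_nonneg hta.le _)) hta.le
  rw [e, e0]
  nlinarith [mul_nonneg h0.le h1]

/-- Lower bound for the continuous operator applied to the truncated power `s ^ (α - 1)`. -/
theorem truncated_power_ge {α θ t : ℝ} (hα0 : 0 < α) (hα1 : α < 1) (hθ : 0 < θ) (hθt : θ ≤ t) :
    (1 - α) ^ 2 * θ ^ α * t ^ (-(1 + α)) ≤
      θ ^ (α - 2) * (t ^ (1 - α) - (t - θ) ^ (1 - α)) - (1 - α) * kernelPrimitive α t θ := by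
  have ht : 0 < t := hθ.trans_le hθt
  have h := rpow_le_tangent (β := 1 - α) (u := t) (v := t - θ) (by linarith) (by linarith) ht
    (by linarith)
  rw [kernelPrimitive]
  set Z := (t - θ) ^ (1 - α) with hZ
  have e1 : θ ^ (α - 1) = θ ^ (α - 2) * θ := by rw [← Real.rpow_add_one hθ.ne']; ring_nf
  have e2 : θ ^ α = θ ^ (α - 2) * θ ^ 2 := by
    rw [← Real.rpow_natCast, ← Real.rpow_add hθ]; norm_num
  have e3 : t ^ (1 - α) = t ^ (-(1 + α)) * t ^ 2 := by
    rw [← Real.rpow_natCast, ← Real.rpow_add ht]; norm_num; ring_nf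
  have e4 : t ^ (1 - α - 1) = t ^ (-(1 + α)) * t := by
    rw [← Real.rpow_add_one ht.ne']; ring_nf
  rw [e3, e4] at h
  rw [e1, e2, e3]
  set X := t ^ (-(1 + α)) with hX
  set Y := θ ^ (α - 2) with hY
  have hY0 : 0 < Y := Real.rpow_pos_of_pos hθ _
  have hX0 : 0 < X := Real.rpow_pos_of_pos ht _
  have key : (1 - α) ^ 2 * θ ^ 2 * X ≤ X * t ^ 2 - Z - (1 - α) * (θ * Z / t) := by
    have hZ1 : Z ≤ X * t ^ 2 - (1 - α) * X * t * θ := by linarith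
    have h1 : θ * Z / t ≤ θ * (X * t - (1 - α) * X * θ) := by
      rw [div_le_iff₀ ht]
      nlinarith [mul_le_mul_of_nonneg_left hZ1 hθ.le]
    nlinarith [mul_le_mul_of_nonneg_left h1 (show 0 ≤ 1 - α by linarith)]
  have := mul_le_mul_of_nonneg_left key hY0.le
  calc _ = Y * ((1 - α) ^ 2 * θ ^ 2 * X) := by ring
    _ ≤ _ := this
    _ = _ := by ring

/-! ### Graded sequences -/

/-- A mesh graded with exponent `r`, normalised so that its first step has length one. -/
structure GradedSeq (r c C : ℝ) (M : ℕ) (x : ℕ → ℝ) : Prop where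
  zero : x 0 = 0
  one : x 1 = 1
  le_step : ∀ j < M, c * ((j + 1 : ℕ) : ℝ) ^ (r - 1) ≤ x (j + 1) - x j
  step_le : ∀ j < M, x (j + 1) - x j ≤ C * ((j + 1 : ℕ) : ℝ) ^ (r - 1)
  le_pow : ∀ j, 1 ≤ j → j ≤ M → x j ≤ C * (j : ℝ) ^ r

namespace GradedSeq

variable {r c C : ℝ} {M : ℕ} {x : ℕ → ℝ}

theorem lt_succ (h : GradedSeq r c C M x) (hc : 0 < c) {j : ℕ} (hj : j < M) :
    x j < x (j + 1) := by
  have h1 := h.le_step j hj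
  have h2 : 0 < c * ((j + 1 : ℕ) : ℝ) ^ (r - 1) := by positivity
  linarith

theorem sub_ge_pow_sub (h : GradedSeq r c C M x) (hr : 1 ≤ r) (hc : 0 < c) {i j : ℕ}
    (hij : i ≤ j) (hj : j ≤ M) : c / r * ((j : ℝ) ^ r - (i : ℝ) ^ r) ≤ x j - x i := by
  induction j, hij using Nat.le_induction with
  | base => simp
  | succ n hn ih =>
    have h1 := ih (by omega)
    have h2 := h.le_step n (by omega)
    have h3 := tangent_le_rpow (u := ((n + 1 : ℕ) : ℝ)) (v := n) hr (by positivity) (by positivity)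
    have h4 : c / r * (((n + 1 : ℕ) : ℝ) ^ r - (n : ℝ) ^ r) ≤
        c * ((n + 1 : ℕ) : ℝ) ^ (r - 1) := by
      rw [div_mul_eq_mul_div, div_le_iff₀ (by linarith), mul_assoc]
      refine mul_le_mul_of_nonneg_left ?_ hc.le
      push_cast at h3 ⊢
      linarith
    linarith

theorem sub_ge (h : GradedSeq r c C M x) (hr : 1 ≤ r) (hc : 0 < c) {i j : ℕ}
    (hij : i ≤ j) (hj : j ≤ M) :
    c / r * ((j : ℝ) ^ (r - 1) * ((j : ℝ) - i)) ≤ x j - x i := by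
  refine le_trans (mul_le_mul_of_nonneg_left ?_ (by positivity)) (h.sub_ge_pow_sub hr hc hij hj)
  rcases Nat.eq_zero_or_pos i with rfl | hi
  · rcases Nat.eq_zero_or_pos j with rfl | hj0
    · simp
    · have : (0 : ℝ) < j := by exact_mod_cast hj0
      rw [Nat.cast_zero, Real.zero_rpow (by linarith), sub_zero, sub_zero,
        ← Real.rpow_add_one this.ne', sub_add_cancel]
  have hi' : (0 : ℝ) < i := by exact_mod_cast hi
  have hij' : (i : ℝ) ≤ j := by exact_mod_cast hij
  have hj' : (0 : ℝ) < j := hi'.trans_le hij'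
  have h1 : (i : ℝ) ^ (r - 1) ≤ (j : ℝ) ^ (r - 1) :=
    Real.rpow_le_rpow hi'.le hij' (by linarith)
  have h2 : (i : ℝ) ^ r = (i : ℝ) ^ (r - 1) * i := by
    rw [← Real.rpow_add_one hi'.ne', sub_add_cancel]
  have h3 : (j : ℝ) ^ r = (j : ℝ) ^ (r - 1) * j := by
    rw [← Real.rpow_add_one hj'.ne', sub_add_cancel]
  rw [h2, h3]
  nlinarith

theorem pow_le (h : GradedSeq r c C M x) (hr : 1 ≤ r) (hc : 0 < c) {j : ℕ} (hj : j ≤ M) :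
    c / r * (j : ℝ) ^ r ≤ x j := by
  have := h.sub_ge_pow_sub hr hc (Nat.zero_le j) hj
  rwa [h.zero, Nat.cast_zero, Real.zero_rpow (by linarith), sub_zero, sub_zero] at this

theorem lt_of_lt (h : GradedSeq r c C M x) (hc : 0 < c) {i j : ℕ} (hij : i < j) (hj : j ≤ M) :
    x i < x j := by
  induction j, hij using Nat.le_induction with
  | base => exact h.lt_succ hc (by omega)
  | succ n hn ih => exact (ih (by omega)).trans (h.lt_succ hc (by omega))

theorem le_of_le (h : GradedSeq r c C M x) (hc : 0 < c) {i j : ℕ} (hij : i ≤ j) (hj : j ≤ M) :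
    x i ≤ x j := by
  rcases hij.eq_or_lt with rfl | hlt
  · exact le_rfl
  · exact (h.lt_of_lt hc hlt hj).le

theorem one_le (h : GradedSeq r c C M x) (hc : 0 < c) {j : ℕ} (hj : 1 ≤ j) (hjM : j ≤ M) :
    1 ≤ x j := h.one ▸ h.le_of_le hc hj hjM

end GradedSeq

/-! ### Truncation error of the truncated power -/

theorem sum_rpow_mul_rpow_sub_le {b : ℝ} (hb : 1 < b) (N : ℕ) :
    ∑ j ∈ Finset.range (N + 1), (j : ℝ) ^ (-b) * ((N - j : ℕ) : ℝ) ^ (-b) ≤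
      2 ^ b * 2 * (∑' n : ℕ, (n : ℝ) ^ (-b)) * (N : ℝ) ^ (-b) := by
  have hs : Summable fun n : ℕ => (n : ℝ) ^ (-b) := Real.summable_nat_rpow.2 (by linarith)
  have hf : ∀ n : ℕ, 0 ≤ (n : ℝ) ^ (-b) := fun n => by positivity
  have half : ∀ i : ℕ, 0 < N → N ≤ 2 * i → (i : ℝ) ^ (-b) ≤ 2 ^ b * (N : ℝ) ^ (-b) := by
    intro i hN0 hN
    have h1 : ((2 : ℝ) * i) ^ (-b) ≤ (N : ℝ) ^ (-b) :=
      Real.rpow_le_rpow_of_nonpos (by exact_mod_cast hN0) (by exact_mod_cast hN) (by linarith)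
    rw [Real.mul_rpow (by norm_num) (by positivity), Real.rpow_neg (by norm_num)] at h1
    have h2 : (0 : ℝ) < 2 ^ b := by positivity
    calc (i : ℝ) ^ (-b) = 2 ^ b * ((2 ^ b)⁻¹ * (i : ℝ) ^ (-b)) := by field_simp
      _ ≤ _ := mul_le_mul_of_nonneg_left h1 h2.le
  have hpt : ∀ j ∈ Finset.range (N + 1), (j : ℝ) ^ (-b) * ((N - j : ℕ) : ℝ) ^ (-b) ≤
      2 ^ b * (N : ℝ) ^ (-b) * ((j : ℝ) ^ (-b) + ((N - j : ℕ) : ℝ) ^ (-b)) := by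
    intro j hj
    have hpos : 0 ≤ 2 ^ b * (N : ℝ) ^ (-b) := by positivity
    rcases Nat.eq_zero_or_pos j with rfl | hj0
    · rw [Nat.cast_zero, Real.zero_rpow (by linarith), zero_mul]
      exact mul_nonneg hpos (add_nonneg le_rfl (hf _))
    rcases Nat.eq_zero_or_pos (N - j) with h0 | h0
    · rw [h0, Nat.cast_zero, Real.zero_rpow (by linarith), mul_zero]
      exact mul_nonneg hpos (add_nonneg (hf _) le_rfl)
    rcases le_total N (2 * j) with h | h
    · nlinarith [mul_le_mul_of_nonneg_right (half j (by omega) h) (hf (N - j)), mul_nonneg hpos (hf j)]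
    · nlinarith [mul_le_mul_of_nonneg_left (half (N - j) (by omega) (by omega)) (hf j),
        mul_nonneg hpos (hf (N - j))]
  have h1 : ∑ j ∈ Finset.range (N + 1), (j : ℝ) ^ (-b) ≤ ∑' n : ℕ, (n : ℝ) ^ (-b) :=
    hs.sum_le_tsum _ fun n _ => hf n
  have h2 := Finset.sum_flip (n := N) fun n : ℕ => (n : ℝ) ^ (-b)
  refine (Finset.sum_le_sum hpt).trans ?_
  rw [← Finset.mul_sum, Finset.sum_add_distrib, h2]
  have hpos : 0 ≤ 2 ^ b * (N : ℝ) ^ (-b) := by positivity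
  nlinarith [mul_le_mul_of_nonneg_left h1 hpos]

theorem exists_truncation_error_le {α r c C : ℝ} (hα0 : 0 < α) (hr : 1 ≤ r)
    (hrα : r * α ≤ 2 - α) (hc : 0 < c) (hC : 0 < C) :
    ∃ K : ℝ, 0 < K ∧ ∀ (M : ℕ) (x : ℕ → ℝ), GradedSeq r c C M x →
      ∀ p N : ℕ, 1 ≤ p → p ≤ N → N + 1 ≤ M →
        ∑ j ∈ Finset.Ico p N, 2 * x j ^ (α - 3) * (x (j + 1) - x j) ^ 3 *
            (x (N + 1) - x (j + 1)) ^ (-(1 + α)) +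
          2 * x N ^ (α - 3) * (x (N + 1) - x N) ^ (2 - α) ≤ K * x (N + 1) ^ (-(1 + α)) := by
  have hα2 : α < 2 := by nlinarith
  set d := c / r with hd
  have hd0 : 0 < d := by positivity
  set S := C * 2 ^ (r - 1) with hS
  have hS0 : 0 < S := by positivity
  set Z := ∑' n : ℕ, (n : ℝ) ^ (-(1 + α)) with hZ
  have hZ0 : 0 ≤ Z := tsum_nonneg fun n => by positivity
  set K1 := 2 * d ^ (α - 3) * S ^ 3 * d ^ (-(1 + α)) with hK1
  set K2 := 2 * d ^ (α - 3) * S ^ (2 - α) with hK2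
  set R := C * 2 ^ r with hR
  refine ⟨(K1 * (2 ^ (1 + α) * 2 * Z) + K2) * R ^ (1 + α), by positivity, ?_⟩
  intro M x hx p N hp hpN hNM
  have hpow : ∀ j : ℕ, 1 ≤ j → j ≤ M → x j ^ (α - 3) ≤ d ^ (α - 3) * (j : ℝ) ^ (r * (α - 3)) := by
    intro j hj hjM
    have hj0 : (0 : ℝ) < j := by exact_mod_cast hj
    rw [Real.rpow_mul hj0.le, ← Real.mul_rpow hd0.le (by positivity)]
    exact Real.rpow_le_rpow_of_nonpos (by positivity) (hx.pow_le hr hc hjM) (by linarith)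
  have hstep : ∀ j : ℕ, 1 ≤ j → j < M → x (j + 1) - x j ≤ S * (j : ℝ) ^ (r - 1) := by
    intro j hj hjM
    refine (hx.step_le j hjM).trans ?_
    rw [hS, mul_assoc, ← Real.mul_rpow (by norm_num) (by positivity)]
    refine mul_le_mul_of_nonneg_left (Real.rpow_le_rpow (by positivity) ?_ (by linarith)) hC.le
    have : (1 : ℝ) ≤ j := by exact_mod_cast hj
    push_cast; linarith
  have hN : 1 ≤ N := hp.trans hpN
  have hN1 : (1 : ℝ) ≤ N := by exact_mod_cast hN
  have hN0 : (0 : ℝ) < N := by linarith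
  have hcell : ∀ j ∈ Finset.Ico p N, 2 * x j ^ (α - 3) * (x (j + 1) - x j) ^ 3 *
      (x (N + 1) - x (j + 1)) ^ (-(1 + α)) ≤ K1 * (N : ℝ) ^ (-((r - 1) * (1 + α))) *
        ((j : ℝ) ^ (-(1 + α)) * ((N - j : ℕ) : ℝ) ^ (-(1 + α))) := by
    intro j hj
    obtain ⟨hpj, hjN⟩ := Finset.mem_Ico.1 hj
    have hj1 : 1 ≤ j := hp.trans hpj
    have hj1' : (1 : ℝ) ≤ j := by exact_mod_cast hj1
    have hj0 : (0 : ℝ) < j := by linarith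
    have hNj : (0 : ℝ) < ((N - j : ℕ) : ℝ) := by exact_mod_cast Nat.sub_pos_of_lt hjN
    have h1 := hpow j hj1 (by omega)
    have h2 : (x (j + 1) - x j) ^ 3 ≤ S ^ 3 * (j : ℝ) ^ (3 * (r - 1)) := by
      have : (j : ℝ) ^ (3 * (r - 1)) = ((j : ℝ) ^ (r - 1)) ^ 3 := by
        rw [← Real.rpow_natCast, ← Real.rpow_mul hj0.le]; congr 1; push_cast; ring
      rw [this, ← mul_pow]
      exact pow_le_pow_left₀ (by linarith [hx.lt_succ hc (j := j) (by omega)])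
        (hstep j hj1 (by omega)) 3
    have h3 : (x (N + 1) - x (j + 1)) ^ (-(1 + α)) ≤ d ^ (-(1 + α)) *
        ((N : ℝ) ^ (-((r - 1) * (1 + α))) * ((N - j : ℕ) : ℝ) ^ (-(1 + α))) := by
      rw [show -((r - 1) * (1 + α)) = (r - 1) * -(1 + α) by ring, Real.rpow_mul hN0.le,
        ← Real.mul_rpow (by positivity) hNj.le, ← Real.mul_rpow hd0.le (by positivity)]
      refine Real.rpow_le_rpow_of_nonpos (by positivity) ?_ (by linarith)
      refine le_trans ?_ (hx.sub_ge hr hc (i := j + 1) (j := N + 1) (by omega) hNM)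
      refine mul_le_mul_of_nonneg_left ?_ hd0.le
      rw [Nat.cast_sub hjN.le, show ((N + 1 : ℕ) : ℝ) - ((j + 1 : ℕ) : ℝ) = (N : ℝ) - j by
        push_cast; ring]
      refine mul_le_mul_of_nonneg_right (Real.rpow_le_rpow hN0.le (by simp) (by linarith)) ?_
      have : (j : ℝ) ≤ N := by exact_mod_cast hjN.le
      linarith
    have hxj : 0 < x j := by linarith [hx.one_le hc hj1 (by omega)]
    have hxs : 0 < x (j + 1) - x j := by linarith [hx.lt_succ hc (j := j) (by omega)]
    have hxN : 0 < x (N + 1) - x (j + 1) := by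
      linarith [hx.lt_of_lt hc (i := j + 1) (j := N + 1) (by omega) hNM]
    have h4 : (j : ℝ) ^ (r * (α - 3)) * (j : ℝ) ^ (3 * (r - 1)) ≤ (j : ℝ) ^ (-(1 + α)) := by
      rw [← Real.rpow_add hj0]
      exact Real.rpow_le_rpow_of_exponent_le hj1' (by linarith)
    calc 2 * x j ^ (α - 3) * (x (j + 1) - x j) ^ 3 * (x (N + 1) - x (j + 1)) ^ (-(1 + α))
        ≤ 2 * (d ^ (α - 3) * (j : ℝ) ^ (r * (α - 3))) * (S ^ 3 * (j : ℝ) ^ (3 * (r - 1))) *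
          (d ^ (-(1 + α)) *
            ((N : ℝ) ^ (-((r - 1) * (1 + α))) * ((N - j : ℕ) : ℝ) ^ (-(1 + α)))) := by
          gcongr
      _ = K1 * (N : ℝ) ^ (-((r - 1) * (1 + α))) * (((j : ℝ) ^ (r * (α - 3)) *
            (j : ℝ) ^ (3 * (r - 1))) * ((N - j : ℕ) : ℝ) ^ (-(1 + α))) := by
          rw [hK1]; ring
      _ ≤ _ := by gcongr
  have hsum : ∑ j ∈ Finset.Ico p N, 2 * x j ^ (α - 3) * (x (j + 1) - x j) ^ 3 *
      (x (N + 1) - x (j + 1)) ^ (-(1 + α)) ≤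
        K1 * (2 ^ (1 + α) * 2 * Z) * (N : ℝ) ^ (-(r * (1 + α))) := by
    refine (Finset.sum_le_sum hcell).trans ?_
    rw [← Finset.mul_sum]
    have h1 : ∑ j ∈ Finset.Ico p N, (j : ℝ) ^ (-(1 + α)) * ((N - j : ℕ) : ℝ) ^ (-(1 + α)) ≤
        2 ^ (1 + α) * 2 * Z * (N : ℝ) ^ (-(1 + α)) := by
      refine (Finset.sum_le_sum_of_subset_of_nonneg ?_ fun j _ _ => by positivity).trans
        (sum_rpow_mul_rpow_sub_le (by linarith) N)
      intro j hj
      have := Finset.mem_Ico.1 hj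
      exact Finset.mem_range.2 (by omega)
    refine (mul_le_mul_of_nonneg_left h1 (by positivity)).trans (le_of_eq ?_)
    rw [show -(r * (1 + α)) = -((r - 1) * (1 + α)) + -(1 + α) by ring, Real.rpow_add hN0]
    ring
  have hlast : 2 * x N ^ (α - 3) * (x (N + 1) - x N) ^ (2 - α) ≤
      K2 * (N : ℝ) ^ (-(r * (1 + α))) := by
    have hxs : 0 < x (N + 1) - x N := by linarith [hx.lt_succ hc (j := N) (by omega)]
    have hxN : 0 < x N := by linarith [hx.one_le hc hN (by omega)]
    have h1 := hpow N hN (by omega)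
    have h2 : (x (N + 1) - x N) ^ (2 - α) ≤ S ^ (2 - α) * (N : ℝ) ^ ((r - 1) * (2 - α)) := by
      rw [Real.rpow_mul hN0.le, ← Real.mul_rpow hS0.le (by positivity)]
      exact Real.rpow_le_rpow hxs.le (hstep N hN (by omega)) (by linarith)
    calc _ ≤ 2 * (d ^ (α - 3) * (N : ℝ) ^ (r * (α - 3))) *
          (S ^ (2 - α) * (N : ℝ) ^ ((r - 1) * (2 - α))) := by gcongr
      _ = K2 * (N : ℝ) ^ (r * (α - 3) + (r - 1) * (2 - α)) := by
          rw [hK2, Real.rpow_add hN0]; ring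
      _ ≤ _ := by
          refine mul_le_mul_of_nonneg_left
            (Real.rpow_le_rpow_of_exponent_le hN1 ?_) (by positivity)
          nlinarith
  have hfin : (N : ℝ) ^ (-(r * (1 + α))) ≤ R ^ (1 + α) * x (N + 1) ^ (-(1 + α)) := by
    have hx1 : 0 < x (N + 1) := by linarith [hx.one_le hc (j := N + 1) (by omega) hNM]
    have h1 : x (N + 1) ≤ R * (N : ℝ) ^ r := by
      refine (hx.le_pow (N + 1) (by omega) hNM).trans ?_
      rw [hR, mul_assoc, ← Real.mul_rpow (by norm_num) (by positivity)]
      refine mul_le_mul_of_nonneg_left (Real.rpow_le_rpow (by positivity) ?_ (by linarith)) hC.le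
      push_cast; linarith
    have hR0 : 0 < R := by positivity
    have h2 := Real.rpow_le_rpow_of_nonpos hx1 h1 (show -(1 + α) ≤ 0 by linarith)
    rw [Real.mul_rpow hR0.le (by positivity), ← Real.rpow_mul hN0.le, Real.rpow_neg hR0.le,
      mul_neg] at h2
    have h3 : 0 < R ^ (1 + α) := by positivity
    calc _ = R ^ (1 + α) * ((R ^ (1 + α))⁻¹ * (N : ℝ) ^ (-(r * (1 + α)))) := by field_simp
      _ ≤ _ := mul_le_mul_of_nonneg_left h2 h3.le
  calc _ ≤ (K1 * (2 ^ (1 + α) * 2 * Z) + K2) * (N : ℝ) ^ (-(r * (1 + α))) := by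
        rw [add_mul]; exact add_le_add hsum hlast
    _ ≤ (K1 * (2 ^ (1 + α) * 2 * Z) + K2) * (R ^ (1 + α) * x (N + 1) ^ (-(1 + α))) :=
        mul_le_mul_of_nonneg_left hfin (by positivity)
    _ = _ := by ring

/-! ### The barrier function -/

/-- The function `s ^ (α - 1)` on the mesh, replaced by a linear function on `[0, x p]`. -/
noncomputable def truncatedPower (α : ℝ) (x : ℕ → ℝ) (p j : ℕ) : ℝ :=
  if j ≤ p then x j * x p ^ (α - 2) else x j ^ (α - 1)

namespace GradedSeq

variable {r c C : ℝ} {M : ℕ} {x : ℕ → ℝ}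

theorem truncatedPower_of_le (h : GradedSeq r c C M x) (hc : 0 < c) (α : ℝ) {p j : ℕ}
    (hp : 1 ≤ p) (hpj : p ≤ j) (hj : j ≤ M) : truncatedPower α x p j = x j ^ (α - 1) := by
  rcases hpj.eq_or_lt with rfl | hlt
  · have : 0 < x p := by linarith [h.one_le hc hp hj]
    rw [truncatedPower, if_pos le_rfl, mul_comm, ← Real.rpow_add_one this.ne']
    ring_nf
  · rw [truncatedPower, if_neg (by omega)]

theorem sum_linear_part (h : GradedSeq r c C M x) (hc : 0 < c) (α : ℝ) {p q m : ℕ}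
    (hqp : q ≤ p) (hqm : q ≤ m) (hm : m ≤ M) :
    ∑ j ∈ Finset.range q,
        (truncatedPower α x p (j + 1) - truncatedPower α x p j) * l1Weight α x m j =
      x p ^ (α - 2) * (x m ^ (1 - α) - (x m - x q) ^ (1 - α)) := by
  have h1 : ∀ j ∈ Finset.range q,
      (truncatedPower α x p (j + 1) - truncatedPower α x p j) * l1Weight α x m j =
      x p ^ (α - 2) * ((x m - x j) ^ (1 - α) - (x m - x (j + 1)) ^ (1 - α)) := by
    intro j hj
    have hj := Finset.mem_range.1 hj
    have h2 := h.lt_succ hc (j := j) (by omega)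
    rw [truncatedPower, truncatedPower, if_pos (by omega), if_pos (by omega), l1Weight]
    have : x (j + 1) - x j ≠ 0 := by linarith
    field_simp
  rw [Finset.sum_congr rfl h1, ← Finset.mul_sum,
    Finset.sum_range_sub' (fun j => (x m - x j) ^ (1 - α)), h.zero, sub_zero]

theorem l1Sum_truncatedPower_of_le (h : GradedSeq r c C M x) (hc : 0 < c) {α : ℝ} (hα : α < 1)
    {p m : ℕ} (hmp : m ≤ p) (hm : m ≤ M) :
    l1Sum α x (truncatedPower α x p) m = x p ^ (α - 2) * x m ^ (1 - α) := by
  rw [l1Sum, h.sum_linear_part hc α hmp le_rfl hm, sub_self, Real.zero_rpow (by linarith),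
    sub_zero]

end GradedSeq

theorem exists_l1Sum_truncatedPower_ge {α r c C : ℝ} (hα0 : 0 < α) (hα1 : α < 1) (hr : 1 ≤ r)
    (hrα : r * α ≤ 2 - α) (hc : 0 < c) (hC : 0 < C) :
    ∃ K : ℝ, 0 < K ∧ ∀ (M : ℕ) (x : ℕ → ℝ), GradedSeq r c C M x →
      ∀ p m : ℕ, 1 ≤ p → p ≤ m → m ≤ M →
        ((1 - α) ^ 2 * x p ^ α - K) * x m ^ (-(1 + α)) ≤ l1Sum α x (truncatedPower α x p) m := by
  obtain ⟨K, hK, herr⟩ := exists_truncation_error_le hα0 hr hrα hc hC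
  refine ⟨K, hK, ?_⟩
  intro M x hx p m hp hpm hm
  have hpos : ∀ j, 1 ≤ j → j ≤ M → 0 < x j := fun j h1 h2 => by linarith [hx.one_le hc h1 h2]
  have hm0 := hpos m (by omega) hm
  have hX : 0 < x m ^ (-(1 + α)) := Real.rpow_pos_of_pos hm0 _
  have hcont := truncated_power_ge hα0 hα1 (hpos p hp (by omega)) (hx.le_of_le hc hpm hm)
  have hlin := hx.sum_linear_part hc α (p := p) (q := p) (m := m) le_rfl hpm hm
  have hend : kernelPrimitive α (x m) (x m) = 0 := by
    rw [kernelPrimitive, sub_self, Real.zero_rpow (by linarith), mul_zero, zero_div]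
  rcases hpm.eq_or_lt with rfl | hlt
  · rw [hend] at hcont
    rw [l1Sum, hlin]
    nlinarith
  obtain ⟨N, rfl⟩ : ∃ N, m = N + 1 := ⟨m - 1, by omega⟩
  have hpN : p ≤ N := by omega
  have hinc : ∀ j, p ≤ j → j < M → (truncatedPower α x p (j + 1) - truncatedPower α x p j) *
      l1Weight α x (N + 1) j = -((x j ^ (α - 1) - x (j + 1) ^ (α - 1)) *
        (((x (N + 1) - x j) ^ (1 - α) - (x (N + 1) - x (j + 1)) ^ (1 - α)) /
          (x (j + 1) - x j))) := by
    intro j hj hjM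
    rw [hx.truncatedPower_of_le hc α hp hj hjM.le,
      hx.truncatedPower_of_le hc α hp (hj.trans j.le_succ) hjM, l1Weight]
    ring
  have hIco : ∑ j ∈ Finset.Ico p N, (x j ^ (α - 1) - x (j + 1) ^ (α - 1)) *
        (((x (N + 1) - x j) ^ (1 - α) - (x (N + 1) - x (j + 1)) ^ (1 - α)) /
          (x (j + 1) - x j)) ≤
      (1 - α) * (kernelPrimitive α (x (N + 1)) (x p) - kernelPrimitive α (x (N + 1)) (x N)) +
      ∑ j ∈ Finset.Ico p N, 2 * x j ^ (α - 3) * (x (j + 1) - x j) ^ 3 *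
            (x (N + 1) - x (j + 1)) ^ (-(1 + α)) := by
    have htel : ∑ j ∈ Finset.Ico p N, (kernelPrimitive α (x (N + 1)) (x j) -
        kernelPrimitive α (x (N + 1)) (x (j + 1))) =
        kernelPrimitive α (x (N + 1)) (x p) - kernelPrimitive α (x (N + 1)) (x N) := by
      have := Finset.sum_Ico_sub (fun j => kernelPrimitive α (x (N + 1)) (x j)) hpN
      rw [← neg_sub (kernelPrimitive α (x (N + 1)) (x N)), ← this, ← Finset.sum_neg_distrib]
      exact Finset.sum_congr rfl fun j _ => by ring
    rw [← htel, Finset.mul_sum, ← Finset.sum_add_distrib]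
    refine Finset.sum_le_sum fun j hj => ?_
    obtain ⟨h1, h2⟩ := Finset.mem_Ico.1 hj
    exact cell_le_of_lt hα0 hα1 (hpos j (by omega) (by omega)) (hx.lt_succ hc (by omega))
      (hx.lt_of_lt hc (by omega) hm)
  have hlast := cell_le_last hα0 hα1 (hpos N (by omega) (by omega))
    (hx.lt_succ hc (j := N) (by omega))
  have he := herr M x hx p N hp hpN hm
  rw [hend] at hlast
  rw [l1Sum, ← Finset.sum_range_add_sum_Ico _ hpm, hlin, Finset.sum_Ico_succ_top hpN,
    hinc N hpN (by omega),
    Finset.sum_congr rfl fun j hj => hinc j (Finset.mem_Ico.1 hj).1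
      (by have := (Finset.mem_Ico.1 hj).2; omega),
    Finset.sum_neg_distrib]
  linarith

/-! ### Superposition of barriers over dyadic scales -/

/-- The growth of the majorant relative to `y ^ (α - 1)`. -/
noncomputable def growthFactor (γ y : ℝ) : ℝ :=
  if 0 < γ then 1 else if γ = 0 then 1 + Real.log y else y ^ (-γ)

theorem one_le_growthFactor (γ : ℝ) {y : ℝ} (hy : 1 ≤ y) : 1 ≤ growthFactor γ y := by
  unfold growthFactor
  split_ifs with h1 h2
  · exact le_rfl
  · linarith [Real.log_nonneg hy]
  · exact Real.one_le_rpow hy (by linarith)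

theorem rpow_le_rpow_abs {y R s : ℝ} (h1 : 1 ≤ y) (h2 : y ≤ R) : y ^ s ≤ R ^ |s| :=
  (Real.rpow_le_rpow_of_exponent_le h1 (le_abs_self s)).trans
    (Real.rpow_le_rpow (by linarith) h2 (abs_nonneg s))

theorem one_le_rpow_abs_mul_rpow {y R s : ℝ} (h1 : 1 ≤ y) (h2 : y ≤ R) :
    1 ≤ R ^ |s| * y ^ s := by
  have h := rpow_le_rpow_abs (s := -s) h1 h2
  have hy : 0 < y ^ s := Real.rpow_pos_of_pos (by linarith) s
  rw [abs_neg] at h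
  calc (1 : ℝ) = y ^ (-s) * y ^ s := by
        rw [← Real.rpow_add (by linarith), neg_add_cancel, Real.rpow_zero]
    _ ≤ _ := mul_le_mul_of_nonneg_right h hy.le

theorem summable_two_rpow_neg_pow {η : ℝ} (hη : 0 < η) :
    Summable fun k : ℕ => ((2 : ℝ) ^ (-η)) ^ k :=
  summable_geometric_of_lt_one (by positivity)
    (Real.rpow_lt_one_of_one_lt_of_neg (by norm_num) (by linarith))

theorem exists_sum_dyadic_le {r c C : ℝ} (γ : ℝ) (hr : 1 ≤ r) (hc : 0 < c) (hC : 0 < C) :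
    ∃ D : ℝ, 0 < D ∧ ∀ (M : ℕ) (x : ℕ → ℝ), GradedSeq r c C M x →
      ∀ p K J : ℕ, 1 ≤ p → p * 2 ^ K ≤ J → J ≤ M →
        ∑ k ∈ Finset.range (K + 1), x (p * 2 ^ k) ^ (-γ) ≤ D * growthFactor γ (x J) := by
  set d := c / r with hd
  have hd0 : 0 < d := by positivity
  rcases lt_trichotomy 0 γ with hγ | rfl | hγ
  · have hs := summable_two_rpow_neg_pow hγ
    set Z := ∑' k : ℕ, ((2 : ℝ) ^ (-γ)) ^ k with hZ
    have hZ0 : 0 < Z := hs.tsum_pos (fun k => by positivity) 0 (by positivity)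
    refine ⟨d ^ (-γ) * Z, by positivity, ?_⟩
    intro M x hx p K J hp hpJ hJ
    rw [growthFactor, if_pos hγ, mul_one]
    have hk : ∀ k ∈ Finset.range (K + 1),
        x (p * 2 ^ k) ^ (-γ) ≤ d ^ (-γ) * ((2 : ℝ) ^ (-γ)) ^ k := by
      intro k hk
      have hkK : k ≤ K := Nat.lt_succ_iff.1 (Finset.mem_range.1 hk)
      have hle : p * 2 ^ k ≤ M :=
        ((Nat.mul_le_mul_left p (Nat.pow_le_pow_right (by norm_num) hkK)).trans hpJ).trans hJ
      have h1 : (2 : ℝ) ^ k ≤ ((p * 2 ^ k : ℕ) : ℝ) := by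
        exact_mod_cast Nat.le_mul_of_pos_left _ hp
      have h2 : (1 : ℝ) ≤ ((p * 2 ^ k : ℕ) : ℝ) := (one_le_pow₀ (by norm_num)).trans h1
      have h3 := Real.rpow_le_rpow_of_exponent_le h2 hr
      rw [Real.rpow_one] at h3
      have h4 : d * 2 ^ k ≤ x (p * 2 ^ k) :=
        (mul_le_mul_of_nonneg_left (h1.trans h3) hd0.le).trans (hx.pow_le hr hc hle)
      refine (Real.rpow_le_rpow_of_nonpos (by positivity) h4 (by linarith)).trans (le_of_eq ?_)
      rw [Real.mul_rpow hd0.le (by positivity), ← Real.rpow_natCast, ← Real.rpow_natCast,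
        ← Real.rpow_mul (by norm_num), ← Real.rpow_mul (by norm_num), mul_comm (k : ℝ)]
    refine (Finset.sum_le_sum hk).trans ?_
    rw [← Finset.mul_sum]
    exact mul_le_mul_of_nonneg_left (hs.sum_le_tsum _ fun k _ => by positivity) (by positivity)
  · refine ⟨2 * |Real.log d| + 2, by positivity, ?_⟩
    intro M x hx p K J hp hpJ hJ
    have hJ1 : 1 ≤ J :=
      (Nat.succ_le_of_lt (Nat.mul_pos hp (Nat.two_pow_pos K))).trans hpJ
    have hxJ := hx.one_le hc hJ1 hJ
    rw [growthFactor, if_neg (lt_irrefl _), if_pos rfl]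
    simp only [neg_zero, Real.rpow_zero, Finset.sum_const, Finset.card_range, nsmul_eq_mul, mul_one]
    have h1 : (2 : ℝ) ^ K ≤ (J : ℝ) := by
      exact_mod_cast (Nat.le_mul_of_pos_left _ hp).trans hpJ
    have h3 := Real.rpow_le_rpow_of_exponent_le (show (1 : ℝ) ≤ J by exact_mod_cast hJ1) hr
    rw [Real.rpow_one] at h3
    have h4 : d * 2 ^ K ≤ x J :=
      (mul_le_mul_of_nonneg_left (h1.trans h3) hd0.le).trans (hx.pow_le hr hc hJ)
    have h5 := Real.log_le_log (by positivity) h4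
    rw [Real.log_mul hd0.ne' (by positivity), Real.log_pow] at h5
    have h6 := neg_abs_le (Real.log d)
    have h7 : (K : ℝ) * (1 / 2) ≤ K * Real.log 2 :=
      mul_le_mul_of_nonneg_left (by linarith [Real.log_two_gt_d9]) (by positivity)
    have h8 := mul_nonneg (abs_nonneg (Real.log d)) (Real.log_nonneg hxJ)
    push_cast
    nlinarith
  · have hη : 0 < -γ := by linarith
    have hs := summable_two_rpow_neg_pow hη
    set q := (2 : ℝ) ^ (-(-γ)) with hq
    set Z := ∑' k : ℕ, q ^ k with hZ
    have hZ0 : 0 < Z := hs.tsum_pos (fun k => by positivity) 0 (by positivity)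
    refine ⟨(C / d) ^ (-γ) * Z, by positivity, ?_⟩
    intro M x hx p K J hp hpJ hJ
    have hJ1 : 1 ≤ J :=
      (Nat.succ_le_of_lt (Nat.mul_pos hp (Nat.two_pow_pos K))).trans hpJ
    have hxJ := hx.one_le hc hJ1 hJ
    rw [growthFactor, if_neg hγ.not_gt, if_neg hγ.ne]
    have hk : ∀ k ∈ Finset.range (K + 1),
        x (p * 2 ^ k) ^ (-γ) ≤ (C / d) ^ (-γ) * x J ^ (-γ) * q ^ (K - k) := by
      intro k hk
      have hkK : k ≤ K := Nat.lt_succ_iff.1 (Finset.mem_range.1 hk)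
      have hsplit : p * 2 ^ k * 2 ^ (K - k) = p * 2 ^ K := by
        rw [mul_assoc, ← pow_add, Nat.add_sub_cancel' hkK]
      have hleJ : p * 2 ^ k * 2 ^ (K - k) ≤ J := hsplit ▸ hpJ
      have hp1 : 1 ≤ p * 2 ^ k := Nat.mul_pos hp (by positivity)
      have hle : p * 2 ^ k ≤ M := ((Nat.le_mul_of_pos_right _ (by positivity)).trans hleJ).trans hJ
      set s := p * 2 ^ k with hsdef
      have hxs : 0 < x s := by linarith [hx.one_le hc hp1 hle]
      have h1 : (s : ℝ) ^ r * 2 ^ (K - k) ≤ (J : ℝ) ^ r := by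
        have h2 : (s : ℝ) * 2 ^ (K - k) ≤ J := by exact_mod_cast hleJ
        have h3 := Real.rpow_le_rpow (by positivity) h2 (show 0 ≤ r by linarith)
        rw [Real.mul_rpow (by positivity) (by positivity)] at h3
        have h4 : (2 : ℝ) ^ (K - k) ≤ ((2 : ℝ) ^ (K - k)) ^ r := by
          have := Real.rpow_le_rpow_of_exponent_le
            (show (1 : ℝ) ≤ 2 ^ (K - k) from one_le_pow₀ (by norm_num)) hr
          rwa [Real.rpow_one] at this
        exact (mul_le_mul_of_nonneg_left h4 (by positivity)).trans h3
      have h5 : x s * 2 ^ (K - k) ≤ C / d * x J := by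
        calc x s * 2 ^ (K - k) ≤ C * (s : ℝ) ^ r * 2 ^ (K - k) :=
              mul_le_mul_of_nonneg_right (hx.le_pow s hp1 hle) (by positivity)
          _ = C * ((s : ℝ) ^ r * 2 ^ (K - k)) := by ring
          _ ≤ C * (J : ℝ) ^ r := mul_le_mul_of_nonneg_left h1 hC.le
          _ = C / d * (d * (J : ℝ) ^ r) := by field_simp
          _ ≤ _ := mul_le_mul_of_nonneg_left (hx.pow_le hr hc hJ) (by positivity)
      have h6 := Real.rpow_le_rpow (by positivity) h5 hη.le
      rw [Real.mul_rpow hxs.le (by positivity), Real.mul_rpow (by positivity) (by linarith)] at h6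
      have h7 : ((2 : ℝ) ^ (K - k)) ^ (-γ) * q ^ (K - k) = 1 := by
        rw [hq, ← Real.rpow_natCast, ← Real.rpow_natCast, ← Real.rpow_mul (by norm_num),
          ← Real.rpow_mul (by norm_num), ← Real.rpow_add (by norm_num),
          show ((K - k : ℕ) : ℝ) * -γ + - -γ * ((K - k : ℕ) : ℝ) = 0 by ring, Real.rpow_zero]
      calc x s ^ (-γ) = x s ^ (-γ) * ((2 : ℝ) ^ (K - k)) ^ (-γ) * q ^ (K - k) := by
            rw [mul_assoc, h7, mul_one]
        _ ≤ _ := mul_le_mul_of_nonneg_right h6 (by positivity)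
    refine (Finset.sum_le_sum hk).trans ?_
    rw [← Finset.mul_sum, Finset.sum_flip (n := K) fun k : ℕ => q ^ k]
    have h1 : ∑ k ∈ Finset.range (K + 1), q ^ k ≤ Z := hs.sum_le_tsum _ fun k _ => by positivity
    have hx0 : 0 < x J := by linarith
    calc _ ≤ (C / d) ^ (-γ) * x J ^ (-γ) * Z := mul_le_mul_of_nonneg_left h1 (by positivity)
      _ = _ := by ring

theorem exists_barrier {α r c C : ℝ} (γ : ℝ) (hα0 : 0 < α) (hα1 : α < 1) (hr : 1 ≤ r)
    (hrα : r * α ≤ 2 - α) (hc : 0 < c) (hC : 0 < C) :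
    ∃ D : ℝ, 0 < D ∧ ∀ (M : ℕ) (x : ℕ → ℝ), GradedSeq r c C M x →
      ∀ J : ℕ, 1 ≤ J → J ≤ M → ∃ W : ℕ → ℝ, W 0 = 0 ∧
        (∀ m, 1 ≤ m → m ≤ J → x m ^ (-(γ + 1)) ≤ l1Sum α x W m) ∧
        W J ≤ D * (x J ^ (α - 1) * growthFactor γ (x J)) := by
  obtain ⟨K, hK, hbar⟩ := exists_l1Sum_truncatedPower_ge hα0 hα1 hr hrα hc hC
  obtain ⟨E, hE, hsum⟩ := exists_sum_dyadic_le γ hr hc hC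
  set d := c / r with hd
  have hd0 : 0 < d := by positivity
  set κ := (1 - α) ^ 2 / 2 with hκ
  have hκ0 : 0 < κ := by have : 0 < 1 - α := by linarith
                         positivity
  obtain ⟨p₀, hp₀⟩ := exists_nat_ge ((K / κ) ^ (1 / α) / d + 1)
  have hKd : 0 ≤ (K / κ) ^ (1 / α) / d := by positivity
  have hp₀1 : 1 ≤ p₀ := by
    have : (1 : ℝ) ≤ p₀ := by linarith
    exact_mod_cast this
  set R := max 1 (C * (p₀ : ℝ) ^ r) with hR
  have hR1 : 1 ≤ R := le_max_left _ _
  have hR0 : 0 < R := by linarith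
  set Q := C * 2 ^ r / d with hQ
  have hQ0 : 0 < Q := by positivity
  set A := R ^ (|γ + 1| + |α - 2 - γ|) + Q ^ |γ - α| / κ with hA
  have hA0 : 0 < A := by positivity
  refine ⟨R ^ |γ + 1| * R ^ (2 - α) + A * E, by positivity, ?_⟩
  intro M x hx J hJ hJM
  have hone : ∀ j, 1 ≤ j → j ≤ J → 1 ≤ x j := fun j h1 h2 => hx.one_le hc h1 (h2.trans hJM)
  have hleR : ∀ j, 1 ≤ j → j ≤ p₀ → j ≤ J → x j ≤ R := by
    intro j h1 h2 h3
    refine (hx.le_pow j h1 (h3.trans hJM)).trans (le_trans ?_ (le_max_right _ _))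
    exact mul_le_mul_of_nonneg_left
      (Real.rpow_le_rpow (by positivity) (by exact_mod_cast h2) (by linarith)) hC.le
  have hxJ := hone J hJ le_rfl
  have hxJ0 : 0 < x J := by linarith
  have hG := one_le_growthFactor γ hxJ
  have hzero : ∀ p, truncatedPower α x p 0 = 0 := fun p => by
    rw [truncatedPower, if_pos (Nat.zero_le p), hx.zero, zero_mul]
  have hxJα : 0 < x J ^ (α - 1) := Real.rpow_pos_of_pos hxJ0 _
  have hbound : ∀ a, a ≤ R ^ |γ + 1| * R ^ (2 - α) + A * E → ∀ y,
      y ≤ a * (x J ^ (α - 1) * growthFactor γ (x J)) →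
      y ≤ (R ^ |γ + 1| * R ^ (2 - α) + A * E) * (x J ^ (α - 1) * growthFactor γ (x J)) :=
    fun a ha y hy => hy.trans (mul_le_mul_of_nonneg_right ha (by positivity))
  rcases lt_or_ge J p₀ with hJp | hJp
  · refine ⟨fun j => R ^ |γ + 1| * x J ^ (2 - α) * truncatedPower α x J j, ?_, ?_, ?_⟩
    · simp only [hzero, mul_zero]
    · intro m hm hmJ
      have hm1 := hone m hm hmJ
      rw [l1Sum_smul, hx.l1Sum_truncatedPower_of_le hc hα1 hmJ (hmJ.trans hJM)]
      have h1 : x J ^ (2 - α) * x J ^ (α - 2) = 1 := by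
        rw [← Real.rpow_add hxJ0]; norm_num
      have h2 : 1 ≤ x m ^ (1 - α) := Real.one_le_rpow hm1 (by linarith)
      have h3 := rpow_le_rpow_abs (s := -(γ + 1)) hm1 (hleR m hm (by omega) hmJ)
      rw [abs_neg] at h3
      calc x m ^ (-(γ + 1)) ≤ R ^ |γ + 1| := h3
        _ ≤ R ^ |γ + 1| * x m ^ (1 - α) := le_mul_of_one_le_right (by positivity) h2
        _ = R ^ |γ + 1| * (x J ^ (2 - α) * x J ^ (α - 2)) * x m ^ (1 - α) := by rw [h1, mul_one]
        _ = _ := by ring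
    · refine hbound (R ^ |γ + 1| * R ^ (2 - α)) (by linarith [mul_pos hA0 hE]) _ ?_
      beta_reduce
      rw [hx.truncatedPower_of_le hc α hJ le_rfl hJM]
      have h1 : x J ^ (2 - α) ≤ R ^ (2 - α) :=
        Real.rpow_le_rpow hxJ0.le (hleR J hJ hJp.le le_rfl) (by linarith)
      calc _ ≤ R ^ |γ + 1| * R ^ (2 - α) * x J ^ (α - 1) := by gcongr
        _ ≤ _ := mul_le_mul_of_nonneg_left (le_mul_of_one_le_right hxJα.le hG) (by positivity)
  have hlarge : ∀ p, p₀ ≤ p → p ≤ J → K ≤ κ * x p ^ α := by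
    intro p h1 h2
    have hp1 : (1 : ℝ) ≤ p := by exact_mod_cast hp₀1.trans h1
    have h3 := Real.rpow_le_rpow_of_exponent_le hp1 hr
    rw [Real.rpow_one] at h3
    have h4 : (K / κ) ^ (1 / α) ≤ x p := by
      refine le_trans ?_ (hx.pow_le hr hc (h2.trans hJM))
      refine le_trans ?_ (mul_le_mul_of_nonneg_left h3 hd0.le)
      have h5 : (p₀ : ℝ) ≤ p := by exact_mod_cast h1
      have h6 : (K / κ) ^ (1 / α) / d ≤ p := by linarith
      rw [div_le_iff₀ hd0] at h6
      linarith
    have h5 := Real.rpow_le_rpow (by positivity) h4 hα0.le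
    rw [← Real.rpow_mul (by positivity), one_div, inv_mul_cancel₀ hα0.ne', Real.rpow_one,
      div_le_iff₀ hκ0] at h5
    linarith
  have hge : ∀ p m, p₀ ≤ p → p ≤ m → m ≤ J →
      κ * x p ^ α * x m ^ (-(1 + α)) ≤ l1Sum α x (truncatedPower α x p) m := by
    intro p m h1 h2 h3
    refine le_trans (mul_le_mul_of_nonneg_right ?_ ?_)
      (hbar M x hx p m (hp₀1.trans h1) h2 (h3.trans hJM))
    · have := hlarge p h1 (h2.trans h3)
      have e : (1 - α) ^ 2 = 2 * κ := by rw [hκ]; ring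
      rw [e]; linarith
    · have := hone m (by omega) h3
      exact Real.rpow_nonneg (by linarith) _
  have hnonneg : ∀ p m, p₀ ≤ p → p ≤ J → 1 ≤ m → m ≤ J →
      0 ≤ l1Sum α x (truncatedPower α x p) m := by
    intro p m h1 h2 h3 h4
    have hm1 := hone m h3 h4
    have hp1 := hone p (hp₀1.trans h1) h2
    rcases le_total m p with h | h
    · rw [hx.l1Sum_truncatedPower_of_le hc hα1 h (h4.trans hJM)]
      exact mul_nonneg (Real.rpow_nonneg (by linarith) _) (Real.rpow_nonneg (by linarith) _)
    · exact le_trans (mul_nonneg (mul_nonneg hκ0.le (Real.rpow_nonneg (by linarith) _))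
        (Real.rpow_nonneg (by linarith) _)) (hge p m h1 h h4)
  set k₁ := Nat.log 2 (J / p₀) with hk₁
  have hdyad : ∀ m, p₀ ≤ m → p₀ * 2 ^ Nat.log 2 (m / p₀) ≤ m := by
    intro m hm
    rw [mul_comm]
    exact (Nat.le_div_iff_mul_le hp₀1).1
      (Nat.pow_log_le_self 2 (Nat.div_pos hm hp₀1).ne')
  have hdyadJ : ∀ k ≤ k₁, p₀ * 2 ^ k ≤ J := fun k hk =>
    (Nat.mul_le_mul_left _ (Nat.pow_le_pow_right (by norm_num) hk)).trans (hdyad J hJp)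
  have hdyad0 : ∀ k, p₀ ≤ p₀ * 2 ^ k := fun k => Nat.le_mul_of_pos_right _ (Nat.two_pow_pos k)
  refine ⟨fun j => A * ∑ k ∈ Finset.range (k₁ + 1),
    x (p₀ * 2 ^ k) ^ (-γ) * truncatedPower α x (p₀ * 2 ^ k) j, ?_, ?_, ?_⟩
  · simp only [hzero, mul_zero, Finset.sum_const_zero]
  · intro m hm hmJ
    have hm1 := hone m hm hmJ
    have hm0 : 0 < x m := by linarith
    rw [l1Sum_smul, l1Sum_sum]
    simp only [l1Sum_smul]
    have hterm : ∀ k ≤ k₁, x (p₀ * 2 ^ k) ^ (-γ) *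
        l1Sum α x (truncatedPower α x (p₀ * 2 ^ k)) m ≤ ∑ k ∈ Finset.range (k₁ + 1),
        x (p₀ * 2 ^ k) ^ (-γ) * l1Sum α x (truncatedPower α x (p₀ * 2 ^ k)) m := by
      intro k hk
      refine Finset.single_le_sum (f := fun k => x (p₀ * 2 ^ k) ^ (-γ) *
        l1Sum α x (truncatedPower α x (p₀ * 2 ^ k)) m) (fun i hi => ?_)
        (Finset.mem_range.2 (Nat.lt_succ_of_le hk))
      have hi := hdyadJ i (Nat.lt_succ_iff.1 (Finset.mem_range.1 hi))
      have := hone _ (hp₀1.trans (hdyad0 i)) hi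
      exact mul_nonneg (Real.rpow_nonneg (by linarith) _) (hnonneg _ m (hdyad0 i) hi hm hmJ)
    rcases lt_or_ge m p₀ with hmp | hmp
    · have h0 := hterm 0 (Nat.zero_le _)
      rw [pow_zero, mul_one, hx.l1Sum_truncatedPower_of_le hc hα1 hmp.le (hmJ.trans hJM)] at h0
      refine le_trans ?_ (mul_le_mul_of_nonneg_left h0 hA0.le)
      have hp1 := hone p₀ hp₀1 hJp
      have hp0 : 0 < x p₀ := by linarith
      have h1 := one_le_rpow_abs_mul_rpow (s := α - 2 - γ) hp1 (hleR p₀ hp₀1 le_rfl hJp)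
      have h2 : 1 ≤ x m ^ (1 - α) := Real.one_le_rpow hm1 (by linarith)
      have h3 := rpow_le_rpow_abs (s := -(γ + 1)) hm1 (hleR m hm hmp.le hmJ)
      rw [abs_neg] at h3
      have h4 : x p₀ ^ (-γ) * x p₀ ^ (α - 2) = x p₀ ^ (α - 2 - γ) := by
        rw [← Real.rpow_add hp0]; ring_nf
      have h5 : R ^ (|γ + 1| + |α - 2 - γ|) ≤ A := by
        have : 0 ≤ Q ^ |γ - α| / κ := by positivity
        linarith
      calc x m ^ (-(γ + 1)) ≤ R ^ |γ + 1| := h3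
        _ ≤ R ^ |γ + 1| * (R ^ |α - 2 - γ| * x p₀ ^ (α - 2 - γ)) :=
            le_mul_of_one_le_right (by positivity) h1
        _ = R ^ (|γ + 1| + |α - 2 - γ|) * x p₀ ^ (α - 2 - γ) := by
            rw [Real.rpow_add hR0]; ring
        _ ≤ A * x p₀ ^ (α - 2 - γ) := mul_le_mul_of_nonneg_right h5 (by positivity)
        _ ≤ A * x p₀ ^ (α - 2 - γ) * x m ^ (1 - α) := le_mul_of_one_le_right (by positivity) h2
        _ = _ := by rw [← h4]; ring
    · set k := Nat.log 2 (m / p₀) with hk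
      have hkk : k ≤ k₁ := Nat.log_mono_right (Nat.div_le_div_right hmJ)
      refine le_trans ?_ (mul_le_mul_of_nonneg_left (hterm k hkk) hA0.le)
      have hpm : p₀ * 2 ^ k ≤ m := hdyad m hmp
      have hlt : m ≤ 2 * (p₀ * 2 ^ k) := by
        have h1 : m / p₀ < 2 ^ (k + 1) := Nat.lt_pow_succ_log_self (by norm_num) _
        have h2 := (Nat.div_lt_iff_lt_mul hp₀1).1 h1
        rw [pow_succ] at h2
        nlinarith
      have hpp := hdyad0 k
      set p := p₀ * 2 ^ k with hp
      have hp1 := hone p (hp₀1.trans hpp) (hpm.trans hmJ)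
      have hp0 : 0 < x p := by linarith
      have hge' := hge p m hpp hpm hmJ
      have hratio : x m / x p ≤ Q := by
        rw [div_le_iff₀ hp0]
        have h1 : (m : ℝ) ≤ 2 * p := by exact_mod_cast hlt
        have h2 := Real.rpow_le_rpow (by positivity) h1 (show 0 ≤ r by linarith)
        rw [Real.mul_rpow (by norm_num) (by positivity)] at h2
        calc x m ≤ C * (m : ℝ) ^ r := hx.le_pow m hm (hmJ.trans hJM)
          _ ≤ C * (2 ^ r * (p : ℝ) ^ r) := mul_le_mul_of_nonneg_left h2 hC.le
          _ = Q * (d * (p : ℝ) ^ r) := by rw [hQ]; field_simp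
          _ ≤ _ := mul_le_mul_of_nonneg_left
              (hx.pow_le hr hc (hpm.trans (hmJ.trans hJM))) hQ0.le
      have hratio1 : 1 ≤ x m / x p := by
        rw [one_le_div hp0]; exact hx.le_of_le hc hpm (hmJ.trans hJM)
      have h1 := one_le_rpow_abs_mul_rpow (s := γ - α) hratio1 hratio
      have h2 : x p ^ (-γ) * (x p ^ α * x m ^ (-(1 + α))) =
          (x m / x p) ^ (γ - α) * x m ^ (-(γ + 1)) := by
        rw [Real.div_rpow hm0.le hp0.le, div_eq_mul_inv, ← Real.rpow_neg hp0.le, ← mul_assoc,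
          ← Real.rpow_add hp0, mul_right_comm, ← Real.rpow_add hm0, mul_comm]
        ring_nf
      have h3 : Q ^ |γ - α| ≤ A * κ := by
        have : Q ^ |γ - α| / κ ≤ A := by
          have : 0 ≤ R ^ (|γ + 1| + |α - 2 - γ|) := by positivity
          linarith
        rwa [div_le_iff₀ hκ0] at this
      have hX : 0 ≤ x m ^ (-(γ + 1)) := by positivity
      calc x m ^ (-(γ + 1)) ≤ Q ^ |γ - α| * (x m / x p) ^ (γ - α) * x m ^ (-(γ + 1)) :=
            le_mul_of_one_le_left hX h1
        _ ≤ A * κ * (x m / x p) ^ (γ - α) * x m ^ (-(γ + 1)) := by gcongr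
        _ = A * (x p ^ (-γ) * (κ * x p ^ α * x m ^ (-(1 + α)))) := by
            rw [mul_assoc (A * κ), ← h2]; ring
        _ ≤ _ := by gcongr
  · refine hbound (A * E) (by
      have : 0 < R ^ |γ + 1| * R ^ (2 - α) := by positivity
      linarith) _ ?_
    have h1 : ∀ k ∈ Finset.range (k₁ + 1),
        x (p₀ * 2 ^ k) ^ (-γ) * truncatedPower α x (p₀ * 2 ^ k) J =
        x (p₀ * 2 ^ k) ^ (-γ) * x J ^ (α - 1) := by
      intro k hk
      rw [hx.truncatedPower_of_le hc α (hp₀1.trans (hdyad0 k))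
        (hdyadJ k (Nat.lt_succ_iff.1 (Finset.mem_range.1 hk))) hJM]
    beta_reduce
    rw [Finset.sum_congr rfl h1, ← Finset.sum_mul]
    have h2 := hsum M x hx p₀ k₁ J hp₀1 (hdyad J hJp) hJM
    calc _ ≤ A * (E * growthFactor γ (x J) * x J ^ (α - 1)) := by gcongr
      _ = _ := by ring

theorem gradedSeq_of_quasiGraded {T r c0 C0 : ℝ} {M : ℕ} {t : ℕ → ℝ} (hr : 1 ≤ r) (hc0 : 0 < c0)
    (hcC : c0 ≤ C0) (ht : IsMesh T M t) (hq : QuasiGraded r c0 C0 M t) :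
    GradedSeq r (c0 * c0 ^ (1 - 1 / r)) (max C0 (C0 * C0 ^ (1 - 1 / r))) M
      (fun j => t j / t 1) := by
  obtain ⟨hM, h0, hlt, -⟩ := ht
  obtain ⟨-, hpow, hstep⟩ := hq
  have hτ : 0 < t 1 := by simpa [h0] using hlt 0 (by omega)
  have hC0 : 0 < C0 := hc0.trans_le hcC
  have hr0 : 0 < r := by linarith
  have hs : 0 ≤ 1 - 1 / r := by
    have : 1 / r ≤ 1 := (div_le_one hr0).2 hr
    linarith
  have hpos : ∀ j, 1 ≤ j → j ≤ M → 0 < t j := by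
    intro j hj
    induction j, hj using Nat.le_induction with
    | base => exact fun _ => hτ
    | succ n hn ih => exact fun h => (ih (by omega)).trans (hlt n (by omega))
  have hexp : ∀ (a : ℝ), 0 < a → ∀ j : ℕ, (a * (j : ℝ) ^ r) ^ (1 - 1 / r) =
      a ^ (1 - 1 / r) * (j : ℝ) ^ (r - 1) := by
    intro a ha j
    rw [Real.mul_rpow ha.le (by positivity), ← Real.rpow_mul (by positivity)]
    congr 2; field_simp
  have hscale : ∀ y, 0 < y → (t 1) ^ (1 / r) * y ^ (1 - 1 / r) / t 1 =
      (y / t 1) ^ (1 - 1 / r) := by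
    intro y hy
    rw [Real.div_rpow hy.le hτ.le, Real.rpow_sub hτ, Real.rpow_one]
    have : 0 < (t 1) ^ (1 / r) := Real.rpow_pos_of_pos hτ _
    field_simp
  refine ⟨by simp [h0], div_self hτ.ne', ?_, ?_, ?_⟩
  · intro j hj
    have h1 := (hstep (j + 1) (by omega) (by omega)).1
    have h2 := (hpow (j + 1) (by omega) (by omega)).1
    rw [Nat.add_sub_cancel] at h1
    have h3 : c0 * ((j + 1 : ℕ) : ℝ) ^ r ≤ t (j + 1) / t 1 := by
      rw [le_div_iff₀ hτ]; linarith
    have h4 := Real.rpow_le_rpow (by positivity) h3 hs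
    rw [hexp c0 hc0] at h4
    have h5 := div_le_div_of_nonneg_right h1 hτ.le
    rw [mul_div_assoc, hscale _ (hpos (j + 1) (by omega) (by omega)), sub_div] at h5
    refine le_trans ?_ h5
    rw [mul_assoc]
    exact mul_le_mul_of_nonneg_left h4 hc0.le
  · intro j hj
    have h1 := (hstep (j + 1) (by omega) (by omega)).2
    have h2 := (hpow (j + 1) (by omega) (by omega)).2
    rw [Nat.add_sub_cancel] at h1
    have htj := hpos (j + 1) (by omega) (by omega)
    have h3 : t (j + 1) / t 1 ≤ C0 * ((j + 1 : ℕ) : ℝ) ^ r := by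
      rw [div_le_iff₀ hτ]; linarith
    have h4 := Real.rpow_le_rpow (by positivity) h3 hs
    rw [hexp C0 hC0] at h4
    have h5 := div_le_div_of_nonneg_right h1 hτ.le
    rw [mul_div_assoc, hscale _ htj, sub_div] at h5
    refine h5.trans ((mul_le_mul_of_nonneg_left h4 hC0.le).trans ?_)
    rw [← mul_assoc]
    exact mul_le_mul_of_nonneg_right (le_max_right _ _) (by positivity)
  · intro j hj hjM
    rw [div_le_iff₀ hτ]
    have h1 := (hpow j hj hjM).2
    have h2 : C0 * (t 1 * (j : ℝ) ^ r) ≤ max C0 (C0 * C0 ^ (1 - 1 / r)) * (t 1 * (j : ℝ) ^ r) :=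
      mul_le_mul_of_nonneg_right (le_max_left _ _) (by positivity)
    linarith

theorem Vcal_eq {α γ τ y : ℝ} (hτ : 0 < τ) (hy : 0 < y) :
    Vcal α γ τ y = τ ^ α * ((y / τ) ^ (α - 1) * growthFactor γ (y / τ)) := by
  have h1 : τ ^ α * (y / τ) ^ (α - 1) = τ * y ^ (α - 1) := by
    rw [Real.div_rpow hy.le hτ.le, Real.rpow_sub_one hτ.ne']
    have := (Real.rpow_pos_of_pos hτ α).ne'
    field_simp
  have h2 : (τ / y) ^ γ = (y / τ) ^ (-γ) := by
    rw [Real.rpow_neg (by positivity), ← Real.inv_rpow (by positivity), inv_div]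
  rw [← mul_assoc, h1, Vcal, growthFactor, h2]
  split_ifs <;> ring

/-- Stability of the L1 discrete fractional-derivative operator on quasi-graded
meshes with `1 ≤ r ≤ (2-α)/α` (Theorem 2.2(i)). -/
theorem stmt0 (α r γ T c0 C0 : ℝ)
    (hα0 : 0 < α) (hα1 : α < 1)
    (hr1 : 1 ≤ r) (hr2 : r ≤ (2 - α) / α)
    (hT : 0 < T) (hc0 : 0 < c0) (hcC : c0 ≤ C0) :
    ∃ C : ℝ, 0 < C ∧
      ∀ (M : ℕ) (t : ℕ → ℝ), IsMesh T M t → QuasiGraded r c0 C0 M t →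
        ∀ V : ℕ → ℝ, V 0 = 0 →
          (∀ j : ℕ, 1 ≤ j → j ≤ M → |deltaL1 α t V j| ≤ (t 1 / t j) ^ (γ + 1)) →
          ∀ j : ℕ, 1 ≤ j → j ≤ M → |V j| ≤ C * Vcal α γ (t 1) (t j) := by
  have hr0 : 0 < r := by linarith
  have hrα : r * α ≤ 2 - α := (le_div_iff₀ hα0).1 hr2
  have hC0 : 0 < C0 := hc0.trans_le hcC
  obtain ⟨D, hD, hbar⟩ := exists_barrier γ hα0 hα1 hr1 hrα
    (show 0 < c0 * c0 ^ (1 - 1 / r) by positivity)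
    (show 0 < max C0 (C0 * C0 ^ (1 - 1 / r)) from lt_max_of_lt_left hC0)
  have hΓ : 0 < Real.Gamma (2 - α) := Real.Gamma_pos_of_pos (by linarith)
  refine ⟨Real.Gamma (2 - α) * D, by positivity, ?_⟩
  intro M t ht hq V hV0 hV J hJ hJM
  have hx := gradedSeq_of_quasiGraded hr1 hc0 hcC ht hq
  have hc : 0 < c0 * c0 ^ (1 - 1 / r) := by positivity
  have hτ : 0 < t 1 := by simpa [ht.2.1] using ht.2.2.1 0 (by have := ht.1; omega)
  set x : ℕ → ℝ := fun j => t j / t 1 with hxdef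
  have hxpos : ∀ j, 1 ≤ j → j ≤ M → 0 < x j := fun j h1 h2 => by
    linarith [hx.one_le hc h1 h2]
  have htpos : ∀ j, 1 ≤ j → j ≤ M → 0 < t j := fun j h1 h2 => by
    have h3 := mul_pos (hxpos j h1 h2) hτ
    rwa [hxdef, div_mul_cancel₀ _ hτ.ne'] at h3
  obtain ⟨W, hW0, hW, hWJ⟩ := hbar M x hx J hJ hJM
  set a := Real.Gamma (2 - α) * t 1 ^ α with ha
  have ha0 : 0 < a := by positivity
  have hres : ∀ m, 1 ≤ m → m ≤ J → |l1Sum α x V m| ≤ a * l1Sum α x W m := by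
    intro m hm hmJ
    have hmM := hmJ.trans hJM
    have h1 := hV m hm hmM
    rw [deltaL1_eq_l1Sum hα1, abs_div, abs_of_pos hΓ, div_le_iff₀ hΓ] at h1
    have h2 : (t 1 / t m) ^ (γ + 1) = x m ^ (-(γ + 1)) := by
      rw [Real.rpow_neg (hxpos m hm hmM).le, ← Real.inv_rpow (hxpos m hm hmM).le, hxdef, inv_div]
    rw [h2] at h1
    have hmono : ∀ j ≤ m, t j ≤ t m := fun j hj => by
      have := hx.le_of_le hc hj hmM
      rwa [hxdef, div_le_div_iff_of_pos_right hτ] at this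
    rw [hxdef, l1Sum_div_mesh hτ hmono, abs_mul, abs_of_pos (Real.rpow_pos_of_pos hτ α), ← hxdef]
    calc _ ≤ t 1 ^ α * (x m ^ (-(γ + 1)) * Real.Gamma (2 - α)) := by gcongr
      _ = a * x m ^ (-(γ + 1)) := by rw [ha]; ring
      _ ≤ _ := mul_le_mul_of_nonneg_left (hW m hm hmJ) ha0.le
  have hlt : ∀ i j, i < j → j ≤ J → x i < x j := fun i j h1 h2 =>
    hx.lt_of_lt hc h1 (h2.trans hJM)
  have hup : V J ≤ a * W J := by
    have := nonneg_of_l1Sum_nonneg hα0 hα1 hlt (U := fun j => a * W j - V j)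
      (by simp [hW0, hV0]) (fun m h1 h2 => by
        rw [l1Sum_sub, l1Sum_smul]
        linarith [(abs_le.1 (hres m h1 h2)).2]) J le_rfl
    linarith
  have hlow : -(a * W J) ≤ V J := by
    have := nonneg_of_l1Sum_nonneg hα0 hα1 hlt (U := fun j => a * W j - (-1) * V j)
      (by simp [hW0, hV0]) (fun m h1 h2 => by
        rw [l1Sum_sub, l1Sum_smul, l1Sum_smul]
        linarith [(abs_le.1 (hres m h1 h2)).1]) J le_rfl
    linarith
  refine (abs_le.2 ⟨hlow, hup⟩).trans ?_
  rw [Vcal_eq hτ (htpos J hJ hJM)]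
  calc a * W J ≤ a * (D * (x J ^ (α - 1) * growthFactor γ (x J))) :=
        mul_le_mul_of_nonneg_left hWJ ha0.le
    _ = _ := by rw [ha]; ring
end

section
/- Let α ∈ (0,1) and let r satisfy 1 ≤ r ≤ (2−α)/α. Let the temporal mesh be quasi-graded with parameter r and constants c_0 ≤ C_0. Then there exist constants c, C > 0, depending only on α, r, T, c_0, C_0, and a real sequence B^0,...,B^M (a discrete barrier function) such that B^0 = 0, 0 ≤ B^j ≤ C t_j^{α−1} for all j = 1,...,M, and δ_t^α B^j ≥ c τ^α t_j^{−α−1} for all j = 1,...,M. -/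
open Real MeasureTheory Set

/-- The graph of `x ↦ x ^ (-q)` lies above its tangent line at `b`. -/
theorem rpow_neg_tangent_le {a b q : ℝ} (ha : 0 < a) (hb : 0 < b) (hq : 0 ≤ q) :
    q * b ^ (-q - 1) * (b - a) ≤ a ^ (-q) - b ^ (-q) := by
  have hab : 0 < a / b := div_pos ha hb
  have h1 : 1 - q * (a / b - 1) ≤ (a / b) ^ (-q) := by
    rw [rpow_def_of_pos hab]
    have h2 := add_one_le_exp (log (a / b) * -q)
    have h3 := mul_le_mul_of_nonneg_left (log_le_sub_one_of_pos hab) hq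
    linarith
  rw [div_rpow ha.le hb.le, le_div_iff₀ (rpow_pos_of_pos hb _)] at h1
  rw [rpow_sub_one hb.ne']
  have h4 : q * (b ^ (-q) / b) * (b - a) = -(q * (a / b - 1)) * b ^ (-q) := by
    field_simp
    ring
  linarith

theorem rpow_neg_sub_le {a b q : ℝ} (ha : 0 < a) (hb : 0 < b) (hq : 0 ≤ q) :
    a ^ (-q) - b ^ (-q) ≤ q * a ^ (-q - 1) * (b - a) := by
  have h := rpow_neg_tangent_le hb ha hq
  linarith

theorem intervalIntegrable_kernel {α : ℝ} (hα : α < 1) (t x y : ℝ) :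
    IntervalIntegrable (fun s => (t - s) ^ (-α)) volume x y := by
  have h : IntervalIntegrable (fun s : ℝ => s ^ (-α)) volume (t - x) (t - y) :=
    intervalIntegral.intervalIntegrable_rpow' (by linarith)
  simpa using h.comp_sub_left t

theorem integral_kernel {α : ℝ} (hα : α < 1) (t x y : ℝ) :
    ∫ s in x..y, (t - s) ^ (-α) = ((t - x) ^ (1 - α) - (t - y) ^ (1 - α)) / (1 - α) := by
  rw [intervalIntegral.integral_comp_sub_left (fun s => s ^ (-α)),
    integral_rpow (Or.inl (by linarith))]
  simp only [neg_add_eq_sub]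

theorem continuousOn_rpow_const_of_pos {x y : ℝ} (hx : 0 < x) (hxy : x ≤ y) (p : ℝ) :
    ContinuousOn (fun s : ℝ => s ^ p) (uIcc x y) := by
  intro s hs
  rw [uIcc_of_le hxy] at hs
  exact (continuousAt_rpow_const s p (Or.inl (hx.trans_le hs.1).ne')).continuousWithinAt

theorem integral_rpow_mul_kernel {α t x y : ℝ} (hα : α < 1) (hx : 0 < x) (hxy : x ≤ y)
    (hyt : y ≤ t) :
    ∫ s in x..y, s ^ (α - 2) * (t - s) ^ (-α) =
      (((t - x) / x) ^ (1 - α) - ((t - y) / y) ^ (1 - α)) / ((1 - α) * t) := by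
  have h1 : (1 - α) ≠ 0 := by linarith
  have ht : 0 < t := by linarith
  have key := intervalIntegral.integral_eq_sub_of_hasDerivAt_of_le hxy
    (f := fun s => -(((t - s) / s) ^ (1 - α) / ((1 - α) * t)))
    (f' := fun s => s ^ (α - 2) * (t - s) ^ (-α)) ?_ ?_ ?_
  · rw [key]
    ring
  · refine ContinuousOn.neg (ContinuousOn.div_const (ContinuousOn.rpow_const ?_ ?_) _)
    · refine ContinuousOn.div (by fun_prop) (by fun_prop) ?_
      intro s hs
      exact (hx.trans_le hs.1).ne'
    · intro s hs
      right
      linarith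
  · intro s hs
    have hs0 : 0 < s := hx.trans hs.1
    have hst : 0 < t - s := by linarith [hs.2]
    have h2 : HasDerivAt (fun s => (t - s) / s) ((-1 * s - (t - s) * 1) / s ^ 2) s :=
      ((hasDerivAt_id s).const_sub t).div (hasDerivAt_id s) hs0.ne'
    have h3 := ((h2.rpow_const (p := 1 - α) (Or.inl (div_pos hst hs0).ne')).div_const
      ((1 - α) * t)).neg
    refine h3.congr_deriv ?_
    have e1 : (1 - α - 1 : ℝ) = -α := by ring
    have e2 : s ^ (α - 2) = s ^ α / s ^ 2 := by
      rw [rpow_sub hs0, rpow_two]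
    rw [e1, e2, div_rpow hst.le hs0.le, rpow_neg hs0.le]
    have : 0 < s ^ α := rpow_pos_of_pos hs0 _
    field_simp
    ring
  · exact (intervalIntegrable_kernel hα t x y).continuousOn_mul
      (continuousOn_rpow_const_of_pos hx hxy _)

theorem integral_kernel_ge {α t x y : ℝ} (hα0 : 0 < α) (hα : α < 1) (hxy : x ≤ y)
    (hyt : y ≤ t) :
    (y - x) * (t - x) ^ (-α) ≤ ∫ s in x..y, (t - s) ^ (-α) := by
  have h := intervalIntegral.integral_mono_on_of_le_Ioo hxy
    (f := fun _ => (t - x) ^ (-α)) (g := fun s => (t - s) ^ (-α)) (μ := volume)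
    intervalIntegrable_const (intervalIntegrable_kernel hα t x y) ?_
  · simpa using h
  · intro s hs
    exact rpow_le_rpow_of_nonpos (by linarith [hs.2]) (by linarith [hs.1]) (by linarith)

theorem integral_kernel_le {α t x y : ℝ} (hα0 : 0 < α) (hα : α < 1) (hxy : x ≤ y)
    (hyt : y < t) :
    ∫ s in x..y, (t - s) ^ (-α) ≤ (y - x) * (t - y) ^ (-α) := by
  have h := intervalIntegral.integral_mono_on_of_le_Ioo hxy
    (f := fun s => (t - s) ^ (-α)) (g := fun _ => (t - y) ^ (-α)) (μ := volume)
    (intervalIntegrable_kernel hα t x y) intervalIntegrable_const ?_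
  · simpa using h
  · intro s hs
    exact rpow_le_rpow_of_nonpos (by linarith [hs.2]) (by linarith [hs.2]) (by linarith)

/-- Local consistency estimate for the piecewise linear interpolant of `s ^ (α - 1)`. -/
theorem slope_mul_integral_kernel_ge {α t x y : ℝ} (hα0 : 0 < α) (hα : α < 1) (hx : 0 < x)
    (hxy : x < y) (hyt : y ≤ t) :
    -((((t - x) / x) ^ (1 - α) - ((t - y) / y) ^ (1 - α)) / t)
      - (1 - α) * (x ^ (α - 2) - y ^ (α - 2)) *
        ((∫ s in x..y, (t - s) ^ (-α)) - (y - x) * (t - x) ^ (-α)) ≤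
    (y ^ (α - 1) - x ^ (α - 1)) / (y - x) * ∫ s in x..y, (t - s) ^ (-α) := by
  have hy : 0 < y := hx.trans hxy
  have hd : 0 < y - x := sub_pos.2 hxy
  have hk := intervalIntegrable_kernel hα t x y
  have hr : IntervalIntegrable (fun s : ℝ => s ^ (α - 2)) volume x y :=
    (continuousOn_rpow_const_of_pos hx hxy.le _).intervalIntegrable
  have hrk := hk.continuousOn_mul (continuousOn_rpow_const_of_pos hx hxy.le (α - 2))
  set σ := (y ^ (α - 1) - x ^ (α - 1)) / (y - x) with hσ
  set k := (t - x) ^ (-α) with hkd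
  set w := (1 - α) * (x ^ (α - 2) - y ^ (α - 2)) with hw
  have hslope : -((1 - α) * x ^ (α - 2)) ≤ σ := by
    rw [hσ, le_div_iff₀ hd]
    have h := rpow_neg_sub_le hx hy (q := 1 - α) (by linarith)
    rw [show -(1 - α) = α - 1 by ring, show α - 1 - 1 = α - 2 by ring] at h
    linarith
  have hI : ∫ s in x..y, s ^ (α - 2) = -(y ^ (α - 1) - x ^ (α - 1)) / (1 - α) := by
    rw [integral_rpow (Or.inr ⟨by linarith, ?_⟩), show α - 2 + 1 = α - 1 by ring]
    · rw [← neg_sub α 1, neg_div_neg_eq]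
    · rw [uIcc_of_le hxy.le]
      exact fun h => absurd h.1 (by linarith)
  have hmono := intervalIntegral.integral_mono_on_of_le_Ioo hxy.le (μ := volume)
    (f := fun s => -w * (t - s) ^ (-α) - -w * k)
    (g := fun s => σ * (t - s) ^ (-α) + (1 - α) * (s ^ (α - 2) * (t - s) ^ (-α)) -
      (σ * k + (1 - α) * k * s ^ (α - 2)))
    ((hk.const_mul _).sub intervalIntegrable_const)
    (((hk.const_mul _).add (hrk.const_mul _)).sub (intervalIntegrable_const.add (hr.const_mul _)))
    (by
      intro s hs
      have hs0 : 0 < s := hx.trans hs.1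
      have h1 : k ≤ (t - s) ^ (-α) :=
        rpow_le_rpow_of_nonpos (by linarith [hs.2]) (by linarith [hs.1]) (by linarith)
      have h2 : y ^ (α - 2) ≤ s ^ (α - 2) :=
        rpow_le_rpow_of_nonpos hs0 hs.2.le (by linarith)
      have h3 : -w ≤ σ + (1 - α) * s ^ (α - 2) := by
        have := mul_le_mul_of_nonneg_left h2 (by linarith : 0 ≤ 1 - α)
        rw [hw]
        linarith
      have h4 := mul_le_mul_of_nonneg_right h3 (sub_nonneg.2 h1)
      linarith)
  rw [intervalIntegral.integral_sub (hk.const_mul _) intervalIntegrable_const,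
    intervalIntegral.integral_sub ((hk.const_mul _).add (hrk.const_mul _))
      (intervalIntegrable_const.add (hr.const_mul _)),
    intervalIntegral.integral_add (hk.const_mul _) (hrk.const_mul _),
    intervalIntegral.integral_add intervalIntegrable_const (hr.const_mul _)] at hmono
  simp only [intervalIntegral.integral_const_mul, intervalIntegral.integral_const,
    smul_eq_mul] at hmono
  rw [integral_rpow_mul_kernel hα hx hxy.le hyt, hI] at hmono
  have e1 : σ * ((y - x) * k) = (y ^ (α - 1) - x ^ (α - 1)) * k := by
    rw [hσ]
    field_simp
  have hα' : (1 - α) ≠ 0 := by linarith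
  have e2 : (1 - α) * k * (-(y ^ (α - 1) - x ^ (α - 1)) / (1 - α)) =
      -(y ^ (α - 1) - x ^ (α - 1)) * k := by
    field_simp
  rw [e1, e2, mul_div_assoc', mul_div_mul_left _ _ hα'] at hmono
  linarith

/-- Lower bound for the fractional derivative of the continuous barrier past `a`. -/
theorem barrier_caputo_ge {α a t : ℝ} (hα0 : 0 < α) (hα : α < 1) (ha : 0 < a) (hat : a ≤ t) :
    (1 - α) * (a ^ α * t ^ (-α - 1)) ≤
      a ^ (α - 2) * ((t ^ (1 - α) - (t - a) ^ (1 - α)) / (1 - α)) -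
        ((t - a) / a) ^ (1 - α) / t := by
  have ht : 0 < t := ha.trans_le hat
  have h1a : 0 < 1 - α := by linarith
  have hb : (1 - a / t) ^ (1 - α) ≤ 1 - (1 - α) * (a / t) := by
    have h := rpow_one_add_le_one_add_mul_self (s := -(a / t)) (p := 1 - α)
      (by have := (div_le_one ht).2 hat; linarith) h1a.le (by linarith)
    rw [← sub_eq_add_neg] at h
    linarith
  have hta : 1 - a / t = (t - a) / t := by field_simp
  have hnn : 0 ≤ t - a := by linarith
  rw [hta, div_rpow hnn ht.le, div_le_iff₀ (rpow_pos_of_pos ht _)] at hb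
  have e1 : t ^ (1 - α) = t ^ (-α) * t := by
    rw [← rpow_add_one ht.ne']
    congr 1
    ring
  have e2 : t ^ (-α - 1) = t ^ (-α) / t := rpow_sub_one ht.ne' _
  have e3 : a ^ (α - 2) = a ^ α / a ^ 2 := by rw [rpow_sub ha, rpow_two]
  have e4 : a ^ (1 - α) = a / a ^ α := by rw [rpow_sub ha, rpow_one]
  rw [e1] at hb
  rw [div_rpow hnn ha.le, e1, e2, e3, e4]
  set X := (t - a) ^ (1 - α)
  set k := t ^ (-α)
  have hA : 0 < a ^ α := rpow_pos_of_pos ha _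
  set A := a ^ α
  have hc : 0 ≤ 1 / (1 - α) + a / t := by positivity
  have hm := mul_le_mul_of_nonneg_left hb hc
  have e5 : A / a ^ 2 * ((k * t - X) / (1 - α)) - X / (a / A) / t =
      A / a ^ 2 * (k * t / (1 - α) - (1 / (1 - α) + a / t) * X) := by
    field_simp
    ring
  have e6 : (1 - α) * (A * (k / t)) = A / a ^ 2 * (k * t / (1 - α) -
      (1 / (1 - α) + a / t) * ((1 - (1 - α) * (a / t)) * (k * t))) := by
    field_simp
    ring
  rw [e5, e6]
  exact mul_le_mul_of_nonneg_left (by linarith) (by positivity)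

theorem integral_kernel_sub_le {α t x y : ℝ} (hα0 : 0 < α) (hα : α < 1) (hx : 0 < x)
    (hxy : x ≤ y) (hyt : y ≤ t / 2) :
    (∫ s in x..y, (t - s) ^ (-α)) - (y - x) * (t - x) ^ (-α) ≤
      α * (t / 2) ^ (-α - 1) * (y - x) ^ 2 := by
  have h1 := integral_kernel_le hα0 hα hxy (t := t) (by linarith)
  have h2 := rpow_neg_sub_le (a := t - y) (b := t - x) (q := α) (by linarith) (by linarith) hα0.le
  have h3 : (t - y) ^ (-α - 1) ≤ (t / 2) ^ (-α - 1) :=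
    rpow_le_rpow_of_nonpos (by linarith) (by linarith) (by linarith)
  have h4 : α * (t - y) ^ (-α - 1) * (t - x - (t - y)) ≤ α * (t / 2) ^ (-α - 1) * (y - x) := by
    rw [show t - x - (t - y) = y - x by ring]
    have : 0 ≤ y - x := by linarith
    gcongr
  have h5 := mul_le_mul_of_nonneg_left (h2.trans h4) (by linarith : 0 ≤ y - x)
  nlinarith

/-- On a quasi-graded cell the weight of the truncation error decays like `y ^ (-1 - q)`,
with `q = 2 / r - α`. -/
theorem weight_le {α r τ κ C x y : ℝ} (hα0 : 0 < α) (hα : α < 1) (hτ : 0 < τ)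
    (hx : 0 < x) (hxy : x < y) (hκ : y ≤ κ * x)
    (hstep : y - x ≤ C * (τ ^ (1 / r) * y ^ (1 - 1 / r))) :
    (1 - α) * (x ^ (α - 2) - y ^ (α - 2)) * (y - x) ≤
      2 * κ ^ (3 - α) * C ^ 2 * τ ^ (2 / r) * y ^ (-(2 / r - α) - 1) := by
  have hy : 0 < y := hx.trans hxy
  have hκ0 : 0 < κ := pos_of_mul_pos_left (hy.trans_le hκ) hx.le
  have hd : 0 ≤ y - x := by linarith
  have h1 : x ^ (α - 2) - y ^ (α - 2) ≤ (2 - α) * x ^ (α - 3) * (y - x) := by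
    have h := rpow_neg_sub_le hx hy (q := 2 - α) (by linarith)
    rwa [show -(2 - α) = α - 2 by ring, show α - 2 - 1 = α - 3 by ring] at h
  have h2 : x ^ (α - 3) ≤ κ ^ (3 - α) * y ^ (α - 3) := by
    have h := rpow_le_rpow_of_nonpos hy hκ (by linarith : α - 3 ≤ 0)
    rw [mul_rpow hκ0.le hx.le] at h
    have h' := mul_le_mul_of_nonneg_left h (rpow_pos_of_pos hκ0 (3 - α)).le
    rwa [← mul_assoc, ← rpow_add hκ0, show 3 - α + (α - 3) = 0 by ring, rpow_zero, one_mul] at h'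
  have h3 : (y - x) ^ 2 ≤ C ^ 2 * τ ^ (2 / r) * y ^ (2 - 2 / r) := by
    calc (y - x) ^ 2 ≤ (C * (τ ^ (1 / r) * y ^ (1 - 1 / r))) ^ 2 := by gcongr
      _ = C ^ 2 * τ ^ (2 / r) * y ^ (2 - 2 / r) := by
        rw [mul_pow, mul_pow, ← rpow_mul_natCast hτ.le, ← rpow_mul_natCast hy.le, mul_assoc]
        congr 3 <;> (push_cast; ring)
  have h4 : y ^ (α - 3) * y ^ (2 - 2 / r) = y ^ (-(2 / r - α) - 1) := by
    rw [← rpow_add hy]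
    congr 1
    ring
  have hX : 0 < x ^ (α - 3) := rpow_pos_of_pos hx _
  have hY : 0 < y ^ (α - 3) := rpow_pos_of_pos hy _
  have hK : 0 < κ ^ (3 - α) := rpow_pos_of_pos hκ0 _
  have hα2 : (1 - α) * (2 - α) ≤ 2 := by nlinarith
  calc (1 - α) * (x ^ (α - 2) - y ^ (α - 2)) * (y - x)
      ≤ (1 - α) * ((2 - α) * x ^ (α - 3) * (y - x)) * (y - x) := by
        have : 0 ≤ 1 - α := by linarith
        gcongr
    _ = (1 - α) * (2 - α) * (x ^ (α - 3) * (y - x) ^ 2) := by ring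
    _ ≤ 2 * (x ^ (α - 3) * (y - x) ^ 2) := by gcongr
    _ ≤ 2 * (κ ^ (3 - α) * y ^ (α - 3) * (C ^ 2 * τ ^ (2 / r) * y ^ (2 - 2 / r))) := by gcongr
    _ = 2 * κ ^ (3 - α) * C ^ 2 * τ ^ (2 / r) * (y ^ (α - 3) * y ^ (2 - 2 / r)) := by ring
    _ = _ := by rw [h4]

/-- The truncation error on one cell is bounded by increments of two monotone quantities. -/
theorem cell_error_le {α r τ κ C t x y K : ℝ} (hα0 : 0 < α) (hα : α < 1) (hq : 0 < 2 / r - α)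
    (hτ : 0 < τ) (hx : 0 < x) (hxy : x < y) (hyt : y ≤ t) (hκ : y ≤ κ * x) (hC : 0 < C)
    (hstep : y - x ≤ C * (τ ^ (1 / r) * y ^ (1 - 1 / r))) (hK : K ≤ (t - x) ^ (-α)) :
    (1 - α) * (x ^ (α - 2) - y ^ (α - 2)) *
        ((∫ s in x..y, (t - s) ^ (-α)) - (y - x) * (t - x) ^ (-α)) ≤
      2 * κ ^ (3 - α) * C ^ 2 * τ ^ (2 / r) *
        (α / (2 / r - α) * (t / 2) ^ (-α - 1) * (x ^ (-(2 / r - α)) - y ^ (-(2 / r - α))) +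
          (t / 2) ^ (-(2 / r - α) - 1) * ((∫ s in x..y, (t - s) ^ (-α)) / (y - x) - K)) := by
  have hy : 0 < y := hx.trans hxy
  have hd : 0 < y - x := sub_pos.2 hxy
  have hw := weight_le hα0 hα hτ hx hxy hκ hstep
  have hκ0 : 0 < κ := pos_of_mul_pos_left (hy.trans_le hκ) hx.le
  have hD : 0 < 2 * κ ^ (3 - α) * C ^ 2 * τ ^ (2 / r) := by positivity
  have hI := integral_kernel_ge hα0 hα hxy.le hyt
  have htan := rpow_neg_tangent_le hx hy hq.le
  set q := 2 / r - α
  set D := 2 * κ ^ (3 - α) * C ^ 2 * τ ^ (2 / r)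
  set I := ∫ s in x..y, (t - s) ^ (-α) with hIdef
  set k := (t - x) ^ (-α)
  have hT : 0 < t / 2 := by linarith
  have hA : 0 < (t / 2) ^ (-α - 1) := rpow_pos_of_pos hT _
  have hB : 0 < (t / 2) ^ (-q - 1) := rpow_pos_of_pos hT _
  have hY : 0 < y ^ (-q - 1) := rpow_pos_of_pos hy _
  have hloss : I - (y - x) * k ≤ (y - x) * (I / (y - x) - K) := by
    rw [mul_sub, mul_div_cancel₀ _ hd.ne']
    nlinarith
  have hKnn : 0 ≤ I / (y - x) - K := by
    rw [sub_nonneg, le_div_iff₀ hd]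
    nlinarith
  have hw0 : 0 ≤ (1 - α) * (x ^ (α - 2) - y ^ (α - 2)) := by
    have : y ^ (α - 2) ≤ x ^ (α - 2) := rpow_le_rpow_of_nonpos hx hxy.le (by linarith)
    exact mul_nonneg (by linarith) (by linarith)
  have hinc : 0 ≤ x ^ (-q) - y ^ (-q) := le_trans (by positivity) htan
  rcases le_total y (t / 2) with h | h
  · have h2 := integral_kernel_sub_le hα0 hα hx hxy.le h
    calc (1 - α) * (x ^ (α - 2) - y ^ (α - 2)) * (I - (y - x) * k)
        ≤ (1 - α) * (x ^ (α - 2) - y ^ (α - 2)) * (α * (t / 2) ^ (-α - 1) * (y - x) ^ 2) := by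
          gcongr
      _ = (1 - α) * (x ^ (α - 2) - y ^ (α - 2)) * (y - x) *
            (α * (t / 2) ^ (-α - 1) * (y - x)) := by ring
      _ ≤ D * y ^ (-q - 1) * (α * (t / 2) ^ (-α - 1) * (y - x)) := by gcongr
      _ = D * (α / q * (t / 2) ^ (-α - 1) * (q * y ^ (-q - 1) * (y - x))) := by
          field_simp
      _ ≤ D * (α / q * (t / 2) ^ (-α - 1) * (x ^ (-q) - y ^ (-q))) := by gcongr
      _ ≤ _ := by
          have := mul_nonneg hB.le hKnn
          gcongr
          linarith
  · have h2 : y ^ (-q - 1) ≤ (t / 2) ^ (-q - 1) :=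
      rpow_le_rpow_of_nonpos hT h (by linarith)
    calc (1 - α) * (x ^ (α - 2) - y ^ (α - 2)) * (I - (y - x) * k)
        ≤ (1 - α) * (x ^ (α - 2) - y ^ (α - 2)) * ((y - x) * (I / (y - x) - K)) := by gcongr
      _ = (1 - α) * (x ^ (α - 2) - y ^ (α - 2)) * (y - x) * (I / (y - x) - K) := by ring
      _ ≤ D * y ^ (-q - 1) * (I / (y - x) - K) := by gcongr
      _ ≤ D * (t / 2) ^ (-q - 1) * (I / (y - x) - K) := by gcongr
      _ = D * ((t / 2) ^ (-q - 1) * (I / (y - x) - K)) := by ring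
      _ ≤ _ := by
          have : 0 ≤ α / q * (t / 2) ^ (-α - 1) * (x ^ (-q) - y ^ (-q)) := by positivity
          gcongr
          linarith

theorem sub_le_sum_Ioc {f g : ℕ → ℝ} {p m : ℕ} (hpm : p ≤ m)
    (h : ∀ j, p < j → j ≤ m → g j - g (j - 1) ≤ f j) :
    g m - g p ≤ ∑ j ∈ Finset.Ioc p m, f j := by
  induction m, hpm using Nat.le_induction with
  | base => simp
  | succ m hpm ih =>
    rw [Finset.sum_Ioc_succ_top hpm]
    have h1 := ih fun j h1 h2 => h j h1 (by omega)
    have h2 := h (m + 1) (by omega) le_rfl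
    rw [Nat.add_sub_cancel] at h2
    linarith

/-- The accumulated truncation error is `O(τ ^ α t ^ (-α - 1))`; this is where the upper
bound on the grading parameter `r` enters. -/
theorem total_error_le {α r τ c a t d D : ℝ} (hα0 : 0 < α) (hα : α < 1) (hr : 0 < r)
    (hr2 : r ≤ (2 - α) / α) (hq : 0 < 2 / r - α) (hτ : 0 < τ) (hτa : τ ≤ a) (hτt : τ ≤ t)
    (hc : 0 < c) (hD : 0 < D)
    (hstep : c * (τ ^ (1 / r) * t ^ (1 - 1 / r)) ≤ d) :
    D * τ ^ (2 / r) * (α / (2 / r - α) * (t / 2) ^ (-α - 1) * a ^ (-(2 / r - α)) +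
        (t / 2) ^ (-(2 / r - α) - 1) * (d ^ (-α) / (1 - α))) ≤
      D * (α / (2 / r - α) * 2 ^ (α + 1) + 2 ^ (2 / r - α + 1) * c ^ (-α) / (1 - α)) *
        (τ ^ α * t ^ (-α - 1)) := by
  have ht : 0 < t := hτ.trans_le hτt
  have h1α : 0 < 1 - α := by linarith
  have hhalf (p : ℝ) : (t / 2) ^ (-p - 1) = 2 ^ (p + 1) * t ^ (-p - 1) := by
    rw [div_rpow ht.le two_pos.le, show p + 1 = -(-p - 1) by ring, rpow_neg two_pos.le (-p - 1)]
    ring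
  have h1 : τ ^ (2 / r) * a ^ (-(2 / r - α)) ≤ τ ^ α := by
    calc τ ^ (2 / r) * a ^ (-(2 / r - α)) ≤ τ ^ (2 / r) * τ ^ (-(2 / r - α)) := by
          have : a ^ (-(2 / r - α)) ≤ τ ^ (-(2 / r - α)) :=
            rpow_le_rpow_of_nonpos hτ hτa (by linarith)
          gcongr
      _ = τ ^ α := by
          rw [← rpow_add hτ]
          congr 1
          ring
  have h2 : d ^ (-α) ≤ c ^ (-α) * (τ ^ (-(α / r)) * t ^ (-α + α / r)) := by
    calc d ^ (-α) ≤ (c * (τ ^ (1 / r) * t ^ (1 - 1 / r))) ^ (-α) :=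
          rpow_le_rpow_of_nonpos (by positivity) hstep (by linarith)
      _ = _ := by
          rw [mul_rpow hc.le (by positivity), mul_rpow (by positivity) (by positivity),
            ← rpow_mul hτ.le, ← rpow_mul ht.le]
          congr 3 <;> ring
  have hexp : 0 ≤ (2 - α) / r - α := by
    rw [le_div_iff₀ hα0] at hr2
    rw [sub_nonneg, le_div_iff₀ hr]
    linarith
  have h3 : τ ^ (2 / r) * (t ^ (-(2 / r - α) - 1) * (τ ^ (-(α / r)) * t ^ (-α + α / r))) ≤
      τ ^ α * t ^ (-α - 1) := by
    calc τ ^ (2 / r) * (t ^ (-(2 / r - α) - 1) * (τ ^ (-(α / r)) * t ^ (-α + α / r)))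
        = (τ ^ (2 / r) * τ ^ (-(α / r))) * (t ^ (-(2 / r - α) - 1) * t ^ (-α + α / r)) := by ring
      _ = (τ ^ α * τ ^ ((2 - α) / r - α)) * (t ^ (-((2 - α) / r - α)) * t ^ (-α - 1)) := by
          rw [← rpow_add hτ, ← rpow_add hτ, ← rpow_add ht, ← rpow_add ht]
          congr 2 <;> ring
      _ ≤ (τ ^ α * t ^ ((2 - α) / r - α)) * (t ^ (-((2 - α) / r - α)) * t ^ (-α - 1)) := by
          gcongr
      _ = τ ^ α * (t ^ ((2 - α) / r - α) * t ^ (-((2 - α) / r - α))) * t ^ (-α - 1) := by ring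
      _ = τ ^ α * t ^ (-α - 1) := by
          rw [← rpow_add ht, add_neg_cancel, rpow_zero, mul_one]
  rw [hhalf, hhalf]
  have hd0 : 0 < d := lt_of_lt_of_le (by positivity) hstep
  calc _ = D * (α / (2 / r - α) * 2 ^ (α + 1)) * (τ ^ (2 / r) * a ^ (-(2 / r - α))) *
          t ^ (-α - 1) + D * (2 ^ (2 / r - α + 1) / (1 - α)) *
          (τ ^ (2 / r) * (t ^ (-(2 / r - α) - 1) * d ^ (-α))) := by ring
    _ ≤ D * (α / (2 / r - α) * 2 ^ (α + 1)) * τ ^ α * t ^ (-α - 1) +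
          D * (2 ^ (2 / r - α + 1) / (1 - α)) * (τ ^ (2 / r) * (t ^ (-(2 / r - α) - 1) *
            (c ^ (-α) * (τ ^ (-(α / r)) * t ^ (-α + α / r))))) := by
        gcongr
    _ = D * (α / (2 / r - α) * 2 ^ (α + 1)) * τ ^ α * t ^ (-α - 1) +
          D * (2 ^ (2 / r - α + 1) / (1 - α)) * c ^ (-α) * (τ ^ (2 / r) *
            (t ^ (-(2 / r - α) - 1) * (τ ^ (-(α / r)) * t ^ (-α + α / r)))) := by ring
    _ ≤ D * (α / (2 / r - α) * 2 ^ (α + 1)) * τ ^ α * t ^ (-α - 1) +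
          D * (2 ^ (2 / r - α + 1) / (1 - α)) * c ^ (-α) * (τ ^ α * t ^ (-α - 1)) := by
        gcongr
    _ = _ := by ring

theorem IsMesh.lt {T : ℝ} {M : ℕ} {t : ℕ → ℝ} (h : IsMesh T M t) {i j : ℕ} (hij : i < j)
    (hj : j ≤ M) : t i < t j := by
  induction j, hij using Nat.le_induction with
  | base => exact h.2.2.1 i hj
  | succ j hij ih => exact (ih (by omega)).trans (h.2.2.1 j hj)

theorem IsMesh.le {T : ℝ} {M : ℕ} {t : ℕ → ℝ} (h : IsMesh T M t) {i j : ℕ} (hij : i ≤ j)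
    (hj : j ≤ M) : t i ≤ t j := by
  rcases hij.eq_or_lt with rfl | hij
  · exact le_rfl
  · exact (h.lt hij hj).le

theorem IsMesh.pos {T : ℝ} {M : ℕ} {t : ℕ → ℝ} (h : IsMesh T M t) {j : ℕ} (hj1 : 1 ≤ j)
    (hj : j ≤ M) : 0 < t j := by
  have := h.lt hj1 hj
  rwa [h.2.1] at this

theorem QuasiGraded.le_mul_pred {r c0 C0 T : ℝ} {M : ℕ} {t : ℕ → ℝ} (h : QuasiGraded r c0 C0 M t)
    (ht : IsMesh T M t) (hr : 0 ≤ r) (hc0 : 0 < c0) (hC0 : 0 < C0) {j : ℕ} (hj1 : 1 < j)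
    (hj : j ≤ M) : t j ≤ C0 * 2 ^ r / c0 * t (j - 1) := by
  have hτ := ht.pos le_rfl (by omega)
  have h1 := (h.2.1 j hj1.le hj).2
  have h2 := (h.2.1 (j - 1) (by omega) (by omega)).1
  have h3 : (j : ℝ) ^ r ≤ 2 ^ r * ((j - 1 : ℕ) : ℝ) ^ r := by
    rw [← mul_rpow two_pos.le (Nat.cast_nonneg _)]
    refine rpow_le_rpow (Nat.cast_nonneg _) ?_ hr
    have : j ≤ 2 * (j - 1) := by omega
    exact_mod_cast this
  calc t j ≤ C0 * (t 1 * (j : ℝ) ^ r) := h1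
    _ ≤ C0 * (t 1 * (2 ^ r * ((j - 1 : ℕ) : ℝ) ^ r)) := by gcongr
    _ = C0 * 2 ^ r / c0 * (c0 * (t 1 * ((j - 1 : ℕ) : ℝ) ^ r)) := by field_simp
    _ ≤ _ := by gcongr

/-- The continuous barrier `min (s a ^ (α - 2), s ^ (α - 1))` with `a = t p`, sampled on the
mesh. -/
noncomputable def barrier (α : ℝ) (t : ℕ → ℝ) (p j : ℕ) : ℝ :=
  if j ≤ p then t p ^ (α - 2) * t j else t j ^ (α - 1)

theorem barrier_of_le {α : ℝ} {t : ℕ → ℝ} {p j : ℕ} (h : j ≤ p) :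
    barrier α t p j = t p ^ (α - 2) * t j :=
  if_pos h

theorem barrier_of_ge {α : ℝ} {t : ℕ → ℝ} {p j : ℕ} (hp : 0 < t p) (h : p ≤ j) :
    barrier α t p j = t j ^ (α - 1) := by
  rcases h.eq_or_lt with rfl | h
  · rw [barrier_of_le le_rfl, ← rpow_add_one hp.ne']
    congr 1
    ring
  · exact if_neg (by omega)

theorem sum_barrier_initial_ge {α T : ℝ} {M p m n : ℕ} {t : ℕ → ℝ} (hα : α < 1)
    (ht : IsMesh T M t) (hn : n ≤ p) (hnM : n ≤ M) :
    t p ^ (α - 2) * ((t m ^ (1 - α) - (t m - t n) ^ (1 - α)) / (1 - α)) ≤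
      ∑ j ∈ Finset.Ioc 0 n, ((barrier α t p j - barrier α t p (j - 1)) / (t j - t (j - 1))) *
        ∫ s in (t (j - 1))..(t j), (t m - s) ^ (-α) := by
  have h := sub_le_sum_Ioc (f := fun j => ((barrier α t p j - barrier α t p (j - 1)) /
      (t j - t (j - 1))) * ∫ s in (t (j - 1))..(t j), (t m - s) ^ (-α))
    (g := fun j => -(t p ^ (α - 2) * ((t m - t j) ^ (1 - α) / (1 - α)))) (Nat.zero_le n) ?_
  · refine le_trans (le_of_eq ?_) h
    simp only [ht.2.1, sub_zero]
    ring
  · intro j hj0 hjn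
    have hlt : t (j - 1) < t j := ht.lt (by omega) (by omega)
    have hne : t j - t (j - 1) ≠ 0 := by linarith
    rw [barrier_of_le (by omega), barrier_of_le (by omega), ← mul_sub,
      mul_div_cancel_right₀ _ hne, integral_kernel hα]
    exact le_of_eq (by ring)

theorem sum_barrier_tail_ge {α r c0 C0 T : ℝ} {M p m : ℕ} {t : ℕ → ℝ} (hα0 : 0 < α) (hα : α < 1)
    (hr : 0 < r) (hq : 0 < 2 / r - α) (hc0 : 0 < c0) (hC0 : 0 < C0) (ht : IsMesh T M t)
    (hg : QuasiGraded r c0 C0 M t) (hp : 1 ≤ p) (hpm : p < m) (hm : m ≤ M) :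
    -(((t m - t p) / t p) ^ (1 - α) / t m) -
      2 * (C0 * 2 ^ r / c0) ^ (3 - α) * C0 ^ 2 * t 1 ^ (2 / r) *
        (α / (2 / r - α) * (t m / 2) ^ (-α - 1) * t p ^ (-(2 / r - α)) +
          (t m / 2) ^ (-(2 / r - α) - 1) * ((t m - t (m - 1)) ^ (-α) / (1 - α))) ≤
      ∑ j ∈ Finset.Ioc p m, ((barrier α t p j - barrier α t p (j - 1)) / (t j - t (j - 1))) *
        ∫ s in (t (j - 1))..(t j), (t m - s) ^ (-α) := by
  set D := 2 * (C0 * 2 ^ r / c0) ^ (3 - α) * C0 ^ 2 * t 1 ^ (2 / r)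
  have hτ := ht.pos le_rfl (by omega : 1 ≤ M)
  have htm := ht.pos (by omega : 1 ≤ m) hm
  have hD : 0 < D := by positivity
  set q := 2 / r - α
  have h1α : 0 < 1 - α := by linarith
  set Kf : ℕ → ℝ := fun j => (∫ s in (t (j - 1))..(t j), (t m - s) ^ (-α)) / (t j - t (j - 1))
    with hKf
  have h := sub_le_sum_Ioc (f := fun j => ((barrier α t p j - barrier α t p (j - 1)) /
      (t j - t (j - 1))) * ∫ s in (t (j - 1))..(t j), (t m - s) ^ (-α))
    (g := fun j => ((t m - t j) / t j) ^ (1 - α) / t m + D * (α / q * (t m / 2) ^ (-α - 1) *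
      t j ^ (-q) - (t m / 2) ^ (-q - 1) * Kf j)) hpm.le ?_
  · refine le_trans ?_ h
    have hKm : Kf m = (t m - t (m - 1)) ^ (-α) / (1 - α) := by
      have hd : 0 < t m - t (m - 1) := sub_pos.2 (ht.lt (by omega) hm)
      simp only [hKf]
      rw [integral_kernel hα, sub_self, zero_rpow h1α.ne', sub_zero, div_right_comm,
        ← rpow_sub_one hd.ne']
      congr 2
      ring
    have hKp : 0 ≤ Kf p := by
      have hd : 0 < t p - t (p - 1) := sub_pos.2 (ht.lt (by omega) (by omega))
      have hpm' := ht.lt hpm hm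
      exact div_nonneg (le_trans (mul_nonneg hd.le (rpow_nonneg (by linarith) _))
        (integral_kernel_ge hα0 hα (by linarith) hpm'.le)) hd.le
    rw [hKm, sub_self, zero_div, zero_rpow h1α.ne', zero_div]
    have h1 : 0 ≤ D * (α / q * (t m / 2) ^ (-α - 1) * t m ^ (-q)) := by positivity
    have h2 : 0 ≤ D * ((t m / 2) ^ (-q - 1) * Kf p) := by positivity
    linarith
  · intro j hj hjm
    have hx := ht.pos (by omega : 1 ≤ j - 1) (by omega)
    have hxy : t (j - 1) < t j := ht.lt (by omega) (by omega)
    have hyt : t j ≤ t m := ht.le hjm hm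
    have hK : Kf (j - 1) ≤ (t m - t (j - 1)) ^ (-α) := by
      have hlt : t (j - 1 - 1) < t (j - 1) := ht.lt (by omega) (by omega)
      have := integral_kernel_le hα0 hα hlt.le (hxy.trans_le hyt)
      simp only [hKf]
      rwa [div_le_iff₀ (sub_pos.2 hlt), mul_comm]
    have h1 := slope_mul_integral_kernel_ge hα0 hα hx hxy hyt
    have h2 : (1 - α) * (t (j - 1) ^ (α - 2) - t j ^ (α - 2)) *
        ((∫ s in (t (j - 1))..(t j), (t m - s) ^ (-α)) -
          (t j - t (j - 1)) * (t m - t (j - 1)) ^ (-α)) ≤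
        D * (α / q * (t m / 2) ^ (-α - 1) * (t (j - 1) ^ (-q) - t j ^ (-q)) +
          (t m / 2) ^ (-q - 1) * (Kf j - Kf (j - 1))) := cell_error_le hα0 hα hq hτ hx hxy hyt
      (hg.le_mul_pred ht hr.le hc0 hC0 (by omega) (by omega)) hC0
      (hg.2.2 j (by omega) (by omega)).2 hK
    have htp := ht.pos hp (by omega)
    rw [barrier_of_ge htp (by omega), barrier_of_ge htp (by omega)]
    refine le_trans ?_ h1
    rw [sub_div (_ ^ (1 - α))]
    linarith

theorem barrier_le {α T : ℝ} {M p j : ℕ} {t : ℕ → ℝ} (hα : α < 1) (ht : IsMesh T M t)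
    (hp : 1 ≤ p) (hpM : p ≤ M) (hj1 : 1 ≤ j) (hj : j ≤ M) :
    0 ≤ barrier α t p j ∧ barrier α t p j ≤ t j ^ (α - 1) := by
  have htp := ht.pos hp hpM
  have htj := ht.pos hj1 hj
  rcases le_total j p with h | h
  · rw [barrier_of_le h]
    refine ⟨by positivity, ?_⟩
    have h1 : t p ^ (α - 2) ≤ t j ^ (α - 2) :=
      rpow_le_rpow_of_nonpos htj (ht.le h hpM) (by linarith)
    calc t p ^ (α - 2) * t j ≤ t j ^ (α - 2) * t j := by gcongr
      _ = t j ^ (α - 1) := by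
        rw [← rpow_add_one htj.ne']
        congr 1
        ring
  · rw [barrier_of_ge htp h]
    exact ⟨by positivity, le_rfl⟩

/-- Lower bound on the linear part of the barrier. -/
theorem sum_barrier_ge_of_le {α T L : ℝ} {M p m : ℕ} {t : ℕ → ℝ} (hα : α < 1)
    (ht : IsMesh T M t) (hpM : p ≤ M) (hL : 0 < L) (hpL : t p ≤ L * t 1)
    (hm1 : 1 ≤ m) (hmp : m ≤ p) :
    L ^ (α - 2) / (1 - α) * (t 1 ^ α * t m ^ (-α - 1)) ≤
      ∑ j ∈ Finset.Ioc 0 m, ((barrier α t p j - barrier α t p (j - 1)) / (t j - t (j - 1))) *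
        ∫ s in (t (j - 1))..(t j), (t m - s) ^ (-α) := by
  have h1α : 0 < 1 - α := by linarith
  refine le_trans ?_ (sum_barrier_initial_ge hα ht hmp (hmp.trans hpM))
  have hτ := ht.pos le_rfl (by omega : 1 ≤ M)
  have htm := ht.pos hm1 (by omega)
  have htp := ht.pos (by omega : 1 ≤ p) hpM
  rw [sub_self, zero_rpow h1α.ne', sub_zero]
  have h1 : L ^ (α - 2) * t 1 ^ (α - 2) ≤ t p ^ (α - 2) := by
    rw [← mul_rpow hL.le hτ.le]
    exact rpow_le_rpow_of_nonpos htp hpL (by linarith)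
  have h2 : t 1 ^ α * t m ^ (-α - 1) ≤ t 1 ^ (α - 2) * t m ^ (1 - α) := by
    rw [show t 1 ^ α = t 1 ^ (α - 2) * t 1 ^ (2 : ℝ) by rw [← rpow_add hτ]; congr 1; ring,
      show t m ^ (1 - α) = t m ^ (2 : ℝ) * t m ^ (-α - 1) by rw [← rpow_add htm]; congr 1; ring,
      mul_assoc]
    have := ht.le hm1 (by omega)
    gcongr
  calc L ^ (α - 2) / (1 - α) * (t 1 ^ α * t m ^ (-α - 1))
      ≤ L ^ (α - 2) / (1 - α) * (t 1 ^ (α - 2) * t m ^ (1 - α)) := by gcongr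
    _ = L ^ (α - 2) * t 1 ^ (α - 2) * (t m ^ (1 - α) / (1 - α)) := by ring
    _ ≤ _ := by gcongr

/-- Lower bound beyond the linear part, once `t p / t 1` beats the truncation error. -/
theorem sum_barrier_ge_of_gt {α r c0 C0 T E : ℝ} {M p m : ℕ} {t : ℕ → ℝ} (hα0 : 0 < α)
    (hα : α < 1) (hr : 0 < r) (hr2 : r ≤ (2 - α) / α) (hq : 0 < 2 / r - α) (hc0 : 0 < c0)
    (hC0 : 0 < C0) (ht : IsMesh T M t) (hg : QuasiGraded r c0 C0 M t)
    (hE : 2 * (C0 * 2 ^ r / c0) ^ (3 - α) * C0 ^ 2 * (α / (2 / r - α) * 2 ^ (α + 1) +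
      2 ^ (2 / r - α + 1) * c0 ^ (-α) / (1 - α)) ≤ E)
    (hp : 1 ≤ p) (hpm : p < m) (hm : m ≤ M)
    (hpL : ((E + 1) / (1 - α)) ^ (1 / α) * t 1 ≤ t p) :
    t 1 ^ α * t m ^ (-α - 1) ≤
      ∑ j ∈ Finset.Ioc 0 m, ((barrier α t p j - barrier α t p (j - 1)) / (t j - t (j - 1))) *
        ∫ s in (t (j - 1))..(t j), (t m - s) ^ (-α) := by
  have h1α : 0 < 1 - α := by linarith
  have hτ := ht.pos le_rfl (by omega : 1 ≤ M)
  have htm := ht.pos (by omega : 1 ≤ m) hm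
  have htp := ht.pos hp (by omega)
  have hD : 0 < 2 * (C0 * 2 ^ r / c0) ^ (3 - α) * C0 ^ 2 := by positivity
  have hE0 : 0 < E := lt_of_lt_of_le (by positivity) hE
  rw [← Finset.sum_Ioc_consecutive _ (Nat.zero_le p) hpm.le]
  have h1 := sum_barrier_initial_ge (m := m) hα ht (le_refl p) (by omega)
  have h2 := sum_barrier_tail_ge hα0 hα hr hq hc0 hC0 ht hg hp hpm hm
  have h3 := barrier_caputo_ge hα0 hα htp (ht.le hpm.le hm)
  have h4 := total_error_le hα0 hα hr hr2 hq hτ (ht.le hp (by omega))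
    (ht.le (by omega : 1 ≤ m) hm) hc0 hD (hg.2.2 m (by omega) hm).1
  have hw : 0 < t 1 ^ α * t m ^ (-α - 1) := by positivity
  have h5 := mul_le_mul_of_nonneg_right hE hw.le
  have h6 : (E + 1) * (t 1 ^ α * t m ^ (-α - 1)) ≤ (1 - α) * (t p ^ α * t m ^ (-α - 1)) := by
    have h7 := rpow_le_rpow (by positivity) hpL hα0.le
    rw [mul_rpow (by positivity) hτ.le, ← rpow_mul (by positivity),
      one_div_mul_cancel hα0.ne', rpow_one] at h7
    calc (E + 1) * (t 1 ^ α * t m ^ (-α - 1))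
        = (1 - α) * ((E + 1) / (1 - α) * t 1 ^ α * t m ^ (-α - 1)) := by field_simp
      _ ≤ _ := by gcongr
  linarith

/-- Existence of a discrete barrier function for the L1 operator on quasi-graded
meshes with `1 ≤ r ≤ (2-α)/α` (Lemma 2.4). -/
theorem stmt3 (α r T c0 C0 : ℝ)
    (hα0 : 0 < α) (hα1 : α < 1)
    (hr1 : 1 ≤ r) (hr2 : r ≤ (2 - α) / α)
    (hT : 0 < T) (hc0 : 0 < c0) (hcC : c0 ≤ C0) :
    ∃ c C : ℝ, 0 < c ∧ 0 < C ∧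
      ∀ (M : ℕ) (t : ℕ → ℝ), IsMesh T M t → QuasiGraded r c0 C0 M t →
        ∃ B : ℕ → ℝ, B 0 = 0 ∧
          (∀ j : ℕ, 1 ≤ j → j ≤ M → 0 ≤ B j ∧ B j ≤ C * (t j) ^ (α - 1)) ∧
          (∀ j : ℕ, 1 ≤ j → j ≤ M →
            c * ((t 1) ^ α * (t j) ^ (-α - 1)) ≤ deltaL1 α t B j) := by
  have hr : 0 < r := by linarith
  have hC0 : 0 < C0 := by linarith
  have h1α : 0 < 1 - α := by linarith
  have hq : 0 < 2 / r - α := by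
    rw [le_div_iff₀ hα0] at hr2
    rw [sub_pos, lt_div_iff₀ hr]
    linarith
  obtain ⟨E, hE⟩ : ∃ E, E = 2 * (C0 * 2 ^ r / c0) ^ (3 - α) * C0 ^ 2 *
    (α / (2 / r - α) * 2 ^ (α + 1) + 2 ^ (2 / r - α + 1) * c0 ^ (-α) / (1 - α)) := ⟨_, rfl⟩
  obtain ⟨P, hP⟩ := exists_nat_ge (max 1 (((E + 1) / (1 - α)) ^ (1 / α) / c0))
  have hP1 : (1 : ℝ) ≤ P := (le_max_left _ _).trans hP
  have hP1' : 1 ≤ P := by exact_mod_cast hP1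
  have hPr : ((E + 1) / (1 - α)) ^ (1 / α) ≤ c0 * (P : ℝ) ^ r := by
    have h1 := (le_max_right _ _).trans hP
    rw [div_le_iff₀ hc0] at h1
    have h2 := rpow_le_rpow_of_exponent_le hP1 hr1
    rw [rpow_one] at h2
    nlinarith
  have hL : 0 < C0 * (P : ℝ) ^ r := by positivity
  have hΓ : 0 < Real.Gamma (1 - α) := Real.Gamma_pos_of_pos h1α
  refine ⟨1 / Real.Gamma (1 - α) * min 1 ((C0 * (P : ℝ) ^ r) ^ (α - 2) / (1 - α)), 1,
    by positivity, one_pos, fun M t ht hg => ?_⟩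
  have hM : 2 ≤ M := ht.1
  have hp1 : 1 ≤ min P M := le_min hP1' (by omega)
  refine ⟨barrier α t (min P M), ?_, fun j hj1 hj => ?_, fun m hm1 hm => ?_⟩
  · rw [barrier_of_le (Nat.zero_le _), ht.2.1, mul_zero]
  · rw [one_mul]
    exact barrier_le hα1 ht hp1 (min_le_right _ _) hj1 hj
  · have hτ := ht.pos le_rfl (by omega)
    have htm := ht.pos hm1 hm
    rw [deltaL1, mul_assoc, show Finset.Icc 1 m = Finset.Ioc 0 m from rfl]
    refine mul_le_mul_of_nonneg_left ?_ (by positivity)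
    rcases le_or_gt m (min P M) with h | h
    · refine le_trans (mul_le_mul_of_nonneg_right (min_le_right _ _) (by positivity))
        (sum_barrier_ge_of_le hα1 ht (min_le_right _ _) hL ?_ hm1 h)
      calc t (min P M) ≤ C0 * (t 1 * ((min P M : ℕ) : ℝ) ^ r) :=
            (hg.2.1 _ hp1 (min_le_right _ _)).2
        _ ≤ C0 * (t 1 * (P : ℝ) ^ r) := by
            have : ((min P M : ℕ) : ℝ) ≤ P := by exact_mod_cast min_le_left _ _
            gcongr
        _ = _ := by ring
    · have hPM : min P M = P := by omega
      rw [hPM] at h ⊢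
      refine le_trans (mul_le_mul_of_nonneg_right (min_le_left _ _) (by positivity)) ?_
      rw [one_mul]
      refine sum_barrier_ge_of_gt hα0 hα1 hr hr2 hq hc0 hC0 ht hg hE.ge hP1' h hm ?_
      calc ((E + 1) / (1 - α)) ^ (1 / α) * t 1 ≤ c0 * (P : ℝ) ^ r * t 1 := by gcongr
        _ = c0 * (t 1 * (P : ℝ) ^ r) := by ring
        _ ≤ t P := (hg.2.1 P hP1' (by omega)).1
end
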